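/- (part of Theorem 1.2: f(M_s⁺) ⊆ M'_s⁺) Under the stated hypotheses, let p ∈ M, let W be an open neighborhood of p in ℂ², and let F : W → ℂ² be holomorphic with F(z) = f(z) for all z ∈ W ∩ D. If p is a strongly pseudoconvex point of ∂D, then F(p) ∈ M' and F(p) is a strongly pseudoconvex point of ∂D'. -/

import Mathlib

noncomputable section

open Complex Filter Metric Set

/-- `ℂ²`. -/
abbrev C2 := ℂ × ℂ

/-- Wirtinger derivative `∂g/∂z₁`. -/
def wd1 (g : C2 → ℂ) (p : C2) : ℂ :=
  (1 / 2 : ℂ) * (fderiv ℝ g p ((1 : ℂ), (0 : ℂ)) - Complex.I * fderiv ℝ g p (Complex.I, (0 : ℂ)))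

/-- Wirtinger derivative `∂g/∂z₂`. -/
def wd2 (g : C2 → ℂ) (p : C2) : ℂ :=
  (1 / 2 : ℂ) * (fderiv ℝ g p ((0 : ℂ), (1 : ℂ)) - Complex.I * fderiv ℝ g p ((0 : ℂ), Complex.I))

/-- Wirtinger derivative `∂g/∂z̄₁`. -/
def wdbar1 (g : C2 → ℂ) (p : C2) : ℂ :=
  (1 / 2 : ℂ) * (fderiv ℝ g p ((1 : ℂ), (0 : ℂ)) + Complex.I * fderiv ℝ g p (Complex.I, (0 : ℂ)))

/-- Wirtinger derivative `∂g/∂z̄₂`. -/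
def wdbar2 (g : C2 → ℂ) (p : C2) : ℂ :=
  (1 / 2 : ℂ) * (fderiv ℝ g p ((0 : ℂ), (1 : ℂ)) + Complex.I * fderiv ℝ g p ((0 : ℂ), Complex.I))

/-- Complexification of a real-valued function. -/
def oc (ρ : C2 → ℝ) : C2 → ℂ := fun p => ((ρ p : ℝ) : ℂ)

/-- Levi form `L_ρ(p)(t) = Σ_{j,k} ∂²ρ/∂z_j∂z̄_k (p) · t_j · conj t_k`. -/
def levi (ρ : C2 → ℝ) (p t : C2) : ℂ :=
  wd1 (wdbar1 (oc ρ)) p * t.1 * (starRingEnd ℂ) t.1 +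
  wd1 (wdbar2 (oc ρ)) p * t.1 * (starRingEnd ℂ) t.2 +
  wd2 (wdbar1 (oc ρ)) p * t.2 * (starRingEnd ℂ) t.1 +
  wd2 (wdbar2 (oc ρ)) p * t.2 * (starRingEnd ℂ) t.2

/-- `t` lies in the complex tangent space at `p` of the level set `{ρ = 0}`:
`∂ρ/∂z₁(p) t₁ + ∂ρ/∂z₂(p) t₂ = 0`. -/
def tangentVec (ρ : C2 → ℝ) (p t : C2) : Prop :=
  wd1 (oc ρ) p * t.1 + wd2 (oc ρ) p * t.2 = 0

/-- Strong pseudoconvexity at `p` w.r.t. the defining function `ρ`: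
the Levi form is positive on all nonzero complex tangent vectors. -/
def StronglyPseudoconvexAt (ρ : C2 → ℝ) (p : C2) : Prop :=
  ∀ t : C2, tangentVec ρ p t → t ≠ 0 → 0 < (levi ρ p t).re

/-- Pseudoconvexity at `p` w.r.t. the defining function `ρ`:
the Levi form is nonnegative on complex tangent vectors. -/
def PseudoconvexAt (ρ : C2 → ℝ) (p : C2) : Prop :=
  ∀ t : C2, tangentVec ρ p t → 0 ≤ (levi ρ p t).re

/-- Levi degeneracy at `p` w.r.t. the defining function `ρ`:
the Levi form vanishes identically on the complex tangent space. -/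
def LeviDegenerateAt (ρ : C2 → ℝ) (p : C2) : Prop :=
  ∀ t : C2, tangentVec ρ p t → levi ρ p t = 0

section
/-- four times the Levi form, in real terms -/
def LL (ρ : C2 → ℝ) (p t : C2) : ℝ :=
  fderiv ℝ (fderiv ℝ ρ) p t t + fderiv ℝ (fderiv ℝ ρ) p (Complex.I • t) (Complex.I • t)

lemma clm_expand {E : Type*} [AddCommGroup E] [Module ℝ E] [TopologicalSpace E]
    (l : C2 →L[ℝ] E) (t : C2) :
    l t = t.1.re • l (1, 0) + t.1.im • l (I, 0) + t.2.re • l (0, 1) + t.2.im • l (0, I) := by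
  rw [← map_smul, ← map_smul, ← map_smul, ← map_smul, ← map_add, ← map_add, ← map_add]
  congr 1
  apply Prod.ext
  · simp
  · simp

lemma oc_fderiv {ρ : C2 → ℝ} {x : C2} (h : DifferentiableAt ℝ ρ x) (v : C2) :
    fderiv ℝ (oc ρ) x v = ((fderiv ℝ ρ x v : ℝ) : ℂ) := by
  have := (Complex.ofRealCLM.hasFDerivAt.comp x h.hasFDerivAt).fderiv
  have h2 : oc ρ = (⇑Complex.ofRealCLM) ∘ ρ := by ext y; simp [oc]
  rw [h2]
  have h3 := congrArg (fun l => l v) this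
  simpa using h3

lemma tangentVec_iff {ρ : C2 → ℝ} {p t : C2} (h : DifferentiableAt ℝ ρ p) :
    tangentVec ρ p t ↔ (fderiv ℝ ρ p t = 0 ∧ fderiv ℝ ρ p (Complex.I • t) = 0) := by
  unfold tangentVec wd1 wd2
  simp only [oc_fderiv h]
  rw [clm_expand (fderiv ℝ ρ p) t, clm_expand (fderiv ℝ ρ p) (I • t)]
  simp only [Complex.ext_iff]
  simp
  constructor
  · rintro ⟨h1, h2⟩; constructor <;> linarith
  · rintro ⟨h1, h2⟩; constructor <;> linarith

lemma diff_of_C2 {ρ : C2 → ℝ} {p : C2} (h : ContDiffAt ℝ 2 ρ p) :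
    ∀ᶠ x in nhds p, DifferentiableAt ℝ ρ x := by
  have := h.eventually (by simp)
  filter_upwards [this] with x hx
  exact hx.differentiableAt (by simp)

lemma diff2_of_C2 {ρ : C2 → ℝ} {p : C2} (h : ContDiffAt ℝ 2 ρ p) :
    DifferentiableAt ℝ (fderiv ℝ ρ) p := by
  have : ContDiffAt ℝ 1 (fderiv ℝ ρ) p := h.fderiv_right (by norm_num)
  exact this.differentiableAt (by simp)

lemma symm_of_C2 {ρ : C2 → ℝ} {p : C2} (h : ContDiffAt ℝ 2 ρ p) (v w : C2) :
    fderiv ℝ (fderiv ℝ ρ) p v w = fderiv ℝ (fderiv ℝ ρ) p w v := by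
  have : IsSymmSndFDerivAt ℝ ρ p := h.isSymmSndFDerivAt (by simp)
  exact this v w

lemma fd_apply {ρ : C2 → ℝ} {p : C2} (h : ContDiffAt ℝ 2 ρ p) (v : C2) :
    HasFDerivAt (fun x => ((fderiv ℝ ρ x v : ℝ) : ℂ))
      (Complex.ofRealCLM.comp ((fderiv ℝ (fderiv ℝ ρ) p).flip v)) p := by
  have h1 := (diff2_of_C2 h).hasFDerivAt
  have h2 : HasFDerivAt (fun x => fderiv ℝ ρ x v) ((fderiv ℝ (fderiv ℝ ρ) p).flip v) p := by
    have := h1.clm_apply (hasFDerivAt_const v p)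
    simpa using this
  exact Complex.ofRealCLM.hasFDerivAt.comp p h2

lemma wdb_fderiv {ρ : C2 → ℝ} {p : C2} (h : ContDiffAt ℝ 2 ρ p) (e e' v : C2) :
    fderiv ℝ (fun x => (1 / 2 : ℂ) * (fderiv ℝ (oc ρ) x e + I * fderiv ℝ (oc ρ) x e')) p v
     = (1 / 2 : ℂ) * ((fderiv ℝ (fderiv ℝ ρ) p v e : ℝ) + I * (fderiv ℝ (fderiv ℝ ρ) p v e' : ℝ)) := by
  have he : (fun x => (1 / 2 : ℂ) * (fderiv ℝ (oc ρ) x e + I * fderiv ℝ (oc ρ) x e')) =ᶠ[nhds p]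
      (fun x => (1 / 2 : ℂ) * (((fderiv ℝ ρ x e : ℝ) : ℂ) + I * ((fderiv ℝ ρ x e' : ℝ) : ℂ))) := by
    filter_upwards [diff_of_C2 h] with x hx
    rw [oc_fderiv hx, oc_fderiv hx]
  rw [he.fderiv_eq]
  have h1 := ((fd_apply h e).add ((fd_apply h e').const_mul I)).const_mul (1/2 : ℂ)
  have h2 := congrArg (fun l => l v) h1.fderiv
  simp at h2 ⊢
  rw [h2]; ring

lemma levi_re {ρ : C2 → ℝ} {p : C2} (h : ContDiffAt ℝ 2 ρ p) (t : C2) :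
    (levi ρ p t).re = LL ρ p t / 4 := by
  unfold levi LL wd1 wd2
  have e1 : wdbar1 (oc ρ) = (fun x => (1 / 2 : ℂ) * (fderiv ℝ (oc ρ) x (1,0) + I * fderiv ℝ (oc ρ) x (I,0))) := rfl
  have e2 : wdbar2 (oc ρ) = (fun x => (1 / 2 : ℂ) * (fderiv ℝ (oc ρ) x (0,1) + I * fderiv ℝ (oc ρ) x (0,I))) := rfl
  rw [e1, e2]
  simp only [wdb_fderiv h]
  have hS := symm_of_C2 h
  set S := fderiv ℝ (fderiv ℝ ρ) p
  rw [clm_expand S t, clm_expand S (I • t)]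
  simp only [add_apply, smul_apply]
  rw [clm_expand (S (1,0)) t, clm_expand (S (I,0)) t, clm_expand (S (0,1)) t, clm_expand (S (0,I)) t,
    clm_expand (S (1,0)) (I • t), clm_expand (S (I,0)) (I • t), clm_expand (S (0,1)) (I • t), clm_expand (S (0,I)) (I • t)]
  rw [hS (I,0) (1,0), hS (0,1) (1,0), hS (0,I) (1,0), hS (0,1) (I,0), hS (0,I) (I,0), hS (0,I) (0,1)]
  simp
  ring

lemma line_deriv_hol {E : Type*} [NormedAddCommGroup E] [NormedSpace ℂ E] {g : C2 → E} {x : C2}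
    (h : DifferentiableAt ℂ g x) (v : C2) :
    HasDerivAt (fun ζ : ℂ => g (x + ζ • v)) (fderiv ℂ g x v) 0 := by
  have h1 : HasDerivAt (fun ζ : ℂ => x + ζ • v) v 0 := by
    simpa using ((hasDerivAt_id (0:ℂ)).smul_const v).const_add x
  have h2 : HasFDerivAt g (fderiv ℂ g x) (x + (0:ℂ) • v) := by simpa using h.hasFDerivAt
  exact h2.comp_hasDerivAt (0:ℂ) h1

lemma line_diffOn {E : Type*} [NormedAddCommGroup E] [NormedSpace ℂ E] {g : C2 → E} {U : Set C2} (hU : IsOpen U)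
    (hg : DifferentiableOn ℂ g U) (x v : C2) :
    DifferentiableOn ℂ (fun ζ : ℂ => g (x + ζ • v)) {ζ | x + ζ • v ∈ U} := by
  intro ζ hζ
  have h1 : DifferentiableAt ℂ (fun ζ : ℂ => x + ζ • v) ζ := by fun_prop
  exact (((hg.differentiableAt (hU.mem_nhds hζ)).comp ζ h1)).differentiableWithinAt

lemma line_ball_mem {x v : C2} {R : ℝ} {ζ : ℂ} (h : ‖ζ‖ * ‖v‖ ≤ R) : x + ζ • v ∈ closedBall x R := by
  simp only [mem_closedBall, dist_eq_norm, add_sub_cancel_left, norm_smul]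
  exact h

lemma cauchy_bd {g : C2 → ℂ} {U : Set C2} (hU : IsOpen U) (hg : DifferentiableOn ℂ g U) {y : C2} {R M : ℝ}
    (hR : 0 < R) (hsub : closedBall y R ⊆ U) (hM : ∀ z ∈ closedBall y R, ‖g z‖ ≤ M) :
    ‖fderiv ℂ g y‖ ≤ M / R := by
  have hM0 : 0 ≤ M := (norm_nonneg _).trans (hM y (mem_closedBall_self hR.le))
  refine ContinuousLinearMap.opNorm_le_bound _ (by positivity) fun w => ?_
  rcases eq_or_ne w 0 with rfl | hw
  · simp
  have hw' : 0 < ‖w‖ := norm_pos_iff.2 hw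
  have hd := line_deriv_hol (hg.differentiableAt (hU.mem_nhds (hsub (mem_closedBall_self hR.le)))) w
  have hmem : ∀ ζ ∈ closedBall (0:ℂ) (R / ‖w‖), y + ζ • w ∈ closedBall y R := by
    intro ζ hζ
    apply line_ball_mem
    simp only [mem_closedBall, dist_zero_right] at hζ
    rwa [le_div_iff₀ hw'] at hζ
  have h2 := Complex.norm_deriv_le_of_forall_mem_sphere_norm_le (c := 0) (R := R / ‖w‖) (C := M)
    (f := fun ζ : ℂ => g (y + ζ • w)) (by positivity)
    (by
      apply DifferentiableOn.diffContOnCl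
      apply (line_diffOn hU hg y w).mono
      intro ζ hζ
      exact hsub (hmem ζ (closure_ball_subset_closedBall hζ)))
    (fun ζ hζ => hM _ (hmem ζ (sphere_subset_closedBall hζ)))
  rw [hd.deriv] at h2
  calc _ ≤ _ := h2
    _ = M / R * ‖w‖ := by field_simp

lemma osgood {g : C2 → ℂ} {U : Set C2} (hU : IsOpen U) (hg : DifferentiableOn ℂ g U) (v : C2) :
    DifferentiableOn ℂ (fun x => fderiv ℂ g x v) U := by
  intro x0 hx0
  apply DifferentiableAt.differentiableWithinAt
  obtain ⟨R0, hR0, hR0U⟩ := Metric.isOpen_iff.1 hU x0 hx0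
  obtain ⟨R, hR, hR3⟩ : ∃ R, 0 < R ∧ 3 * R < R0 := ⟨R0 / 4, by linarith, by linarith⟩
  have hsub : closedBall x0 (3 * R) ⊆ U := (closedBall_subset_ball hR3).trans hR0U
  obtain ⟨M, hM⟩ := (isCompact_closedBall x0 (3 * R)).exists_bound_of_continuousOn (hg.continuousOn.mono hsub)
  set s := R / (‖v‖ + 1) with hs
  have hs0 : 0 < s := by positivity
  have hsv : s * ‖v‖ ≤ R := by
    rw [hs, div_mul_eq_mul_div, div_le_iff₀ (by positivity)]
    nlinarith [norm_nonneg v]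
  have hcm : ∀ θ, ‖circleMap 0 s θ‖ = s := by intro θ; simp [abs_of_pos hs0]
  have hmem : ∀ x ∈ ball x0 R, ∀ ζ : ℂ, ‖ζ‖ ≤ s → x + ζ • v ∈ closedBall x0 (2 * R) := by
    intro x hx ζ hζ
    have h1 : x + ζ • v ∈ closedBall x R := line_ball_mem (le_trans (by gcongr) hsv)
    rw [mem_closedBall] at *
    rw [mem_ball] at hx
    linarith [dist_triangle (x + ζ • v) x x0]
  have hmemU : ∀ x ∈ ball x0 R, ∀ ζ : ℂ, ‖ζ‖ ≤ s → x + ζ • v ∈ U := fun x hx ζ hζ =>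
    hsub (closedBall_subset_closedBall (by linarith) (hmem x hx ζ hζ))
  -- integral representation
  have hrep : ∀ x ∈ ball x0 R, fderiv ℂ g x v = ∫ θ in (0:ℝ)..2 * Real.pi,
      ((2 * Real.pi * I : ℂ)⁻¹ * (deriv (circleMap 0 s) θ * ((circleMap 0 s θ) ^ 2)⁻¹)) * g (x + circleMap 0 s θ • v) := by
    intro x hx
    have hxU : x ∈ U := by simpa using hmemU x hx 0 (by simpa using hs0.le)
    have hd := line_deriv_hol (hg.differentiableAt (hU.mem_nhds hxU)) v
    have hopen : IsOpen {ζ : ℂ | x + ζ • v ∈ U} := hU.preimage (by fun_prop)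
    have h1 := Complex.two_pi_I_inv_smul_circleIntegral_sub_sq_inv_smul_of_differentiable
      (U := {ζ : ℂ | x + ζ • v ∈ U}) (c := 0) (w₀ := 0) (R := s) (f := fun ζ : ℂ => g (x + ζ • v)) hopen
      (fun ζ hζ => hmemU x hx ζ (by simpa using hζ)) (line_diffOn hU hg x v) (by simpa using hs0)
    rw [hd.deriv] at h1
    rw [← h1, circleIntegral, smul_eq_mul, ← intervalIntegral.integral_const_mul]
    congr 1
    ext θ
    simp only [smul_eq_mul, sub_zero]
    ring
  have hev : (fun x => fderiv ℂ g x v) =ᶠ[nhds x0] fun x => ∫ θ in (0:ℝ)..2 * Real.pi,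
      ((2 * Real.pi * I : ℂ)⁻¹ * (deriv (circleMap 0 s) θ * ((circleMap 0 s θ) ^ 2)⁻¹)) * g (x + circleMap 0 s θ • v) :=
    Filter.eventuallyEq_of_mem (ball_mem_nhds x0 hR) hrep
  refine DifferentiableAt.congr_of_eventuallyEq ?_ hev
  set k : ℝ → ℂ := fun θ => (2 * Real.pi * I : ℂ)⁻¹ * (deriv (circleMap 0 s) θ * ((circleMap 0 s θ) ^ 2)⁻¹) with hk
  have hkc : Continuous k := by
    have h0 : ∀ θ, circleMap 0 s θ ≠ 0 := fun θ => by
      rw [← norm_pos_iff, hcm]; exact hs0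
    have h1 : Continuous (fun θ => ((circleMap 0 s θ) ^ 2)⁻¹) :=
      ((continuous_circleMap 0 s).pow 2).inv₀ (fun θ => pow_ne_zero 2 (h0 θ))
    have h2 : Continuous (deriv (circleMap 0 s)) := by
      have : deriv (circleMap 0 s) = fun θ => circleMap 0 s θ * I := by
        ext θ; exact deriv_circleMap _ _ _
      rw [this]; exact (continuous_circleMap 0 s).mul continuous_const
    exact continuous_const.mul (h2.mul h1)
  have hgc : ∀ x ∈ ball x0 R, Continuous (fun θ : ℝ => g (x + circleMap 0 s θ • v)) := by
    intro x hx
    apply hg.continuousOn.comp_continuous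
    · exact continuous_const.add ((continuous_circleMap 0 s).smul continuous_const)
    · intro θ; exact hmemU x hx _ (hcm θ).le
  have hbd : ∀ x ∈ ball x0 R, ∀ θ, ‖fderiv ℂ g (x + circleMap 0 s θ • v)‖ ≤ M / R := by
    intro x hx θ
    have h1 := hmem x hx _ (hcm θ).le
    have h2 : closedBall (x + circleMap 0 s θ • v) R ⊆ closedBall x0 (3 * R) := by
      apply closedBall_subset_closedBall'
      rw [mem_closedBall] at h1
      linarith
    exact cauchy_bd hU hg hR (h2.trans hsub) (fun z hz => hM z (h2 hz))
  have := intervalIntegral.hasFDerivAt_integral_of_dominated_of_fderiv_le (𝕜 := ℂ) (μ := MeasureTheory.volume)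
    (F := fun (x : C2) (θ : ℝ) => k θ * g (x + circleMap 0 s θ • v))
    (F' := fun (x : C2) (θ : ℝ) => k θ • fderiv ℂ g (x + circleMap 0 s θ • v)) (a := 0) (b := 2 * Real.pi)
    (s := ball x0 R) (x₀ := x0) (bound := fun θ => ‖k θ‖ * (M / R)) (ball_mem_nhds x0 hR)
    (by
      filter_upwards [ball_mem_nhds x0 hR] with x hx
      exact (hkc.mul (hgc x hx)).aestronglyMeasurable)
    ((hkc.mul (hgc x0 (mem_ball_self hR))).intervalIntegrable _ _)
    (by
      apply MeasureTheory.AEStronglyMeasurable.smul hkc.aestronglyMeasurable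
      apply Measurable.aestronglyMeasurable
      apply (measurable_fderiv ℂ g).comp
      exact (continuous_const.add ((continuous_circleMap 0 s).smul continuous_const)).measurable)
    (by
      refine Filter.Eventually.of_forall fun θ _ x hx => ?_
      rw [norm_smul]
      gcongr
      exact hbd x hx θ)
    ((hkc.norm.mul continuous_const).intervalIntegrable _ _)
    (by
      refine Filter.Eventually.of_forall fun θ _ x hx => ?_
      apply HasFDerivAt.const_mul
      have h1 : HasFDerivAt g (fderiv ℂ g (x + circleMap 0 s θ • v)) (x + circleMap 0 s θ • v) :=
        (hg.differentiableAt (hU.mem_nhds (hmemU x hx _ (hcm θ).le))).hasFDerivAt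
      have h2 := h1.comp x ((hasFDerivAt_id x).add_const (circleMap 0 s θ • v))
      rw [ContinuousLinearMap.comp_id] at h2
      exact h2)
  exact this.differentiableAt

lemma clm_coord (l : C2 →L[ℂ] ℂ) :
    l = (l (1, 0)) • ContinuousLinearMap.fst ℂ ℂ ℂ + (l (0, 1)) • ContinuousLinearMap.snd ℂ ℂ ℂ := by
  ext <;> simp

lemma hol_contDiffOn (n : ℕ) : ∀ {g : C2 → ℂ} {U : Set C2}, IsOpen U → DifferentiableOn ℂ g U →
    ContDiffOn ℂ n g U := by
  induction n with
  | zero => intro g U hU hg; exact contDiffOn_zero.2 hg.continuousOn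
  | succ n ih =>
    intro g U hU hg
    push_cast
    rw [contDiffOn_succ_iff_fderiv_of_isOpen hU]
    refine ⟨hg, by simp, ?_⟩
    have : fderiv ℂ g = fun x => (fderiv ℂ g x (1, 0)) • ContinuousLinearMap.fst ℂ ℂ ℂ +
        (fderiv ℂ g x (0, 1)) • ContinuousLinearMap.snd ℂ ℂ ℂ := by
      ext1 x; exact clm_coord _
    rw [this]
    exact ((ih hU (osgood hU hg _)).smul contDiffOn_const).add ((ih hU (osgood hU hg _)).smul contDiffOn_const)

lemma hol_contDiffOn2 (n : ℕ) {F : C2 → C2} {U : Set C2} (hU : IsOpen U) (hg : DifferentiableOn ℂ F U) :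
    ContDiffOn ℂ n F U :=
  (hol_contDiffOn n hU hg.fst).prodMk (hol_contDiffOn n hU hg.snd)

/-- chain rule for `LL` -/
lemma LL_comp {ρ : C2 → ℝ} {F : C2 → C2} {z : C2} (hF : ContDiffAt ℂ 2 F z) (hρ : ContDiffAt ℝ 2 ρ (F z)) (t : C2) :
    LL (ρ ∘ F) z t = LL ρ (F z) (fderiv ℂ F z t) := by
  have hFd : ∀ᶠ x in nhds z, DifferentiableAt ℂ F x := by
    filter_upwards [hF.eventually (by simp)] with x hx
    exact hx.differentiableAt (by simp)
  have hFdd : DifferentiableAt ℂ (fderiv ℂ F) z := by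
    have : ContDiffAt ℂ 1 (fderiv ℂ F) z := hF.fderiv_right (by norm_num)
    exact this.differentiableAt (by simp)
  have hev : fderiv ℝ (ρ ∘ F) =ᶠ[nhds z] fun x => (fderiv ℝ ρ (F x)).comp ((fderiv ℂ F x).restrictScalars ℝ) := by
    filter_upwards [hFd, hF.continuousAt.eventually (diff_of_C2 hρ)] with x hx hx2
    have h1 : HasFDerivAt F ((fderiv ℂ F x).restrictScalars ℝ) x := hx.hasFDerivAt.restrictScalars ℝ
    exact (hx2.hasFDerivAt.comp x h1).fderiv
  have hC : ContDiffAt ℝ 2 (ρ ∘ F) z := hρ.comp z (hF.restrict_scalars ℝ)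
  have key : ∀ v : C2, fderiv ℝ (fderiv ℝ (ρ ∘ F)) z v v =
      fderiv ℝ (fderiv ℝ ρ) (F z) (fderiv ℂ F z v) (fderiv ℂ F z v) + fderiv ℝ ρ (F z) (fderiv ℂ (fderiv ℂ F) z v v) := by
    intro v
    have h1 : HasFDerivAt (fun x => fderiv ℝ (ρ ∘ F) x v) ((fderiv ℝ (fderiv ℝ (ρ ∘ F)) z).flip v) z := by
      have := (diff2_of_C2 hC).hasFDerivAt.clm_apply (hasFDerivAt_const v z)
      simpa using this
    have hFz : HasFDerivAt F ((fderiv ℂ F z).restrictScalars ℝ) z :=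
      hFd.self_of_nhds.hasFDerivAt.restrictScalars ℝ
    have h2 := (diff2_of_C2 hρ).hasFDerivAt.comp z hFz
    have h3 : HasFDerivAt (fun x => fderiv ℂ F x v) ((fderiv ℂ (fderiv ℂ F) z).flip v) z := by
      have := hFdd.hasFDerivAt.clm_apply (hasFDerivAt_const v z)
      simpa using this
    have h4 := h2.clm_apply (h3.restrictScalars ℝ)
    have h5 : (fun x => fderiv ℝ (ρ ∘ F) x v) =ᶠ[nhds z] (fun x => fderiv ℝ ρ (F x) (fderiv ℂ F x v)) := by
      filter_upwards [hev] with x hx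
      rw [hx]; rfl
    have h6 := (h4.congr_of_eventuallyEq h5).unique h1
    have h7 := congrArg (fun l => l v) h6
    simp at h7
    rw [← h7]
    ring
  unfold LL
  rw [key, key]
  simp only [map_smul, smul_apply, smul_smul, I_mul_I]
  simp
  ring

end

section
set_option maxSynthPendingDepth 3

lemma contAt_D2 {Φ : C2 → ℝ} {q : C2} (h : ContDiffAt ℝ 2 Φ q) :
    ContinuousAt (fderiv ℝ (fderiv ℝ Φ)) q := by
  have h1 : ContDiffAt ℝ 1 (fderiv ℝ Φ) q := h.fderiv_right (by norm_num)
  have h2 : ContDiffAt ℝ 0 (fderiv ℝ (fderiv ℝ Φ)) q := h1.fderiv_right (by norm_num)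
  exact h2.continuousAt

lemma contAt_D1 {Φ : C2 → ℝ} {q : C2} (h : ContDiffAt ℝ 2 Φ q) :
    ContinuousAt (fderiv ℝ Φ) q := by
  have h1 : ContDiffAt ℝ 1 (fderiv ℝ Φ) q := h.fderiv_right (by norm_num)
  exact h1.continuousAt

lemma D2_near {Φ : C2 → ℝ} {q : C2} (h : ContDiffAt ℝ 2 Φ q) {κ : ℝ} (hκ : 0 < κ) :
    ∀ᶠ z in nhds q, ‖fderiv ℝ (fderiv ℝ Φ) z - fderiv ℝ (fderiv ℝ Φ) q‖ ≤ κ := by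
  have h1 : ContinuousAt (fun z => ‖fderiv ℝ (fderiv ℝ Φ) z - fderiv ℝ (fderiv ℝ Φ) q‖) q :=
    ((contAt_D2 h).sub continuousAt_const).norm
  have h2 := h1.eventually_lt (g := fun _ => κ) continuousAt_const (by simpa using hκ)
  filter_upwards [h2] with z hz using hz.le

lemma norm_I_smul (t : C2) : ‖I • t‖ = ‖t‖ := by rw [norm_smul]; simp

lemma I_I_smul (t : C2) : I • (I • t) = -t := by rw [smul_smul, I_mul_I]; simp

lemma taylor_o {Φ : C2 → ℝ} {q : C2} (h : ContDiffAt ℝ 2 Φ q) {κ : ℝ} (hκ : 0 < κ) :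
    ∃ ε > 0, (∀ z ∈ ball q ε, ContDiffAt ℝ 2 Φ z) ∧ ∀ x ∈ ball q ε, ∀ y ∈ ball q ε,
      |Φ y - Φ x - fderiv ℝ Φ x (y - x) - 1 / 2 * fderiv ℝ (fderiv ℝ Φ) q (y - x) (y - x)| ≤ κ * ‖y - x‖ ^ 2 := by
  have h1 : ∀ᶠ z in nhds q, ContDiffAt ℝ 2 Φ z ∧ ‖fderiv ℝ (fderiv ℝ Φ) z - fderiv ℝ (fderiv ℝ Φ) q‖ ≤ κ := by
    refine (h.eventually (by simp)).and ?_
    exact D2_near h hκ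
  obtain ⟨ε, hε, hb⟩ := Metric.eventually_nhds_iff_ball.1 h1
  refine ⟨ε, hε, fun z hz => (hb z hz).1, fun x hx y hy => ?_⟩
  set S := fderiv ℝ (fderiv ℝ Φ) q
  have hconv : Convex ℝ (ball q ε) := convex_ball q ε
  have hh : ∀ z ∈ ball q ε, ‖fderiv ℝ Φ z - fderiv ℝ Φ x - S (z - x)‖ ≤ κ * ‖z - x‖ := by
    intro z hz
    have := hconv.norm_image_sub_le_of_norm_hasFDerivWithin_le (𝕜 := ℝ)
      (f := fun z => fderiv ℝ Φ z - S z) (f' := fun z => fderiv ℝ (fderiv ℝ Φ) z - S) (C := κ)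
      (fun w hw => ((diff2_of_C2 (hb w hw).1).hasFDerivAt.sub S.hasFDerivAt).hasFDerivWithinAt)
      (fun w hw => (hb w hw).2) hx hz
    have e : fderiv ℝ Φ z - fderiv ℝ Φ x - S (z - x) = fderiv ℝ Φ z - S z - (fderiv ℝ Φ x - S x) := by
      rw [map_sub]; abel
    rw [e]; exact this
  have hg : ∀ z ∈ ball q ε, HasFDerivAt (fun z => Φ z - Φ x - fderiv ℝ Φ x (z - x) - 1 / 2 * S (z - x) (z - x))
      (fderiv ℝ Φ z - fderiv ℝ Φ x - S (z - x)) z := by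
    intro z hz
    have e1 := ((hb z hz).1.differentiableAt (by simp)).hasFDerivAt
    have e0 : HasFDerivAt (fun z : C2 => z - x) (ContinuousLinearMap.id ℝ C2) z := (hasFDerivAt_id z).sub_const x
    have e2 := (fderiv ℝ Φ x).hasFDerivAt.comp z e0
    have e3 := ((S.hasFDerivAt.comp z e0).clm_apply e0).const_mul (1/2 : ℝ)
    have e4 := ((e1.sub_const (Φ x)).sub e2).sub e3
    refine e4.congr_fderiv ?_
    have hs : ∀ u w, S u w = S w u := symm_of_C2 h
    ext v <;> simp
    · rw [hs (v, 0) z, hs (v, 0) x]; ring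
    · rw [hs (0, v) z, hs (0, v) x]; ring
  have hseg : segment ℝ x y ⊆ ball q ε := hconv.segment_subset hx hy
  have := (convex_segment x y).norm_image_sub_le_of_norm_hasFDerivWithin_le (𝕜 := ℝ) (C := κ * ‖y - x‖)
      (fun w hw => (hg w (hseg hw)).hasFDerivWithinAt)
      (fun w hw => (hh w (hseg hw)).trans (by
        have : ‖w - x‖ ≤ ‖y - x‖ := norm_sub_le_of_mem_segment hw
        gcongr)) (left_mem_segment ℝ x y) (right_mem_segment ℝ x y)
  rw [Real.norm_eq_abs] at this
  convert this using 1
  · simp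
  · ring

lemma LL_smul_real (Φ : C2 → ℝ) (q t : C2) (c : ℝ) : LL Φ q (c • t) = c ^ 2 * LL Φ q t := by
  unfold LL
  rw [smul_comm I c t]
  simp
  ring

lemma LL_diff_le (Φ : C2 → ℝ) (Ψ : C2 → ℝ) (z q t : C2) :
    |LL Φ z t - LL Ψ q t| ≤ 2 * ‖fderiv ℝ (fderiv ℝ Φ) z - fderiv ℝ (fderiv ℝ Ψ) q‖ * ‖t‖ ^ 2 := by
  set T := fderiv ℝ (fderiv ℝ Φ) z - fderiv ℝ (fderiv ℝ Ψ) q with hT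
  have : LL Φ z t - LL Ψ q t = T t t + T (I • t) (I • t) := by
    simp [LL, hT]; ring
  rw [this]
  have h1 := T.le_opNorm₂ t t
  have h2 := T.le_opNorm₂ (I • t) (I • t)
  rw [norm_I_smul] at h2
  calc _ ≤ |T t t| + |T (I • t) (I • t)| := abs_add_le _ _
    _ ≤ _ := by rw [Real.norm_eq_abs] at h1 h2; nlinarith

lemma LL_lower {Φ : C2 → ℝ} {q : C2} (hpos : ∀ t, t ≠ 0 → 0 < LL Φ q t) :
    ∃ m > 0, ∀ t, m * ‖t‖ ^ 2 ≤ LL Φ q t := by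
  have hc : Continuous (fun t => LL Φ q t) := by
    unfold LL
    fun_prop
  have hne : (sphere (0 : C2) 1).Nonempty := ⟨(1, 0), by simp⟩
  obtain ⟨t0, ht0, hmin⟩ := (isCompact_sphere (0 : C2) 1).exists_isMinOn hne hc.continuousOn
  have ht00 : t0 ≠ 0 := by rintro rfl; simp at ht0
  refine ⟨LL Φ q t0, hpos t0 ht00, fun t => ?_⟩
  rcases eq_or_ne t 0 with rfl | ht
  · simp [LL]
  have hn : 0 < ‖t‖ := norm_pos_iff.2 ht
  have h1 := hmin (a := (‖t‖⁻¹ : ℝ) • t) (by simp [norm_smul, hn.ne'])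
  simp only [mem_ofPred_eq, LL_smul_real] at h1
  rw [inv_pow, inv_mul_eq_div, le_div_iff₀ (by positivity)] at h1
  exact h1

lemma LL_lower_near {Φ : C2 → ℝ} {q : C2} (h : ContDiffAt ℝ 2 Φ q) (hpos : ∀ t, t ≠ 0 → 0 < LL Φ q t) :
    ∃ m > 0, ∀ᶠ z in nhds q, ∀ t, m * ‖t‖ ^ 2 ≤ LL Φ z t := by
  obtain ⟨m, hm, hL⟩ := LL_lower hpos
  refine ⟨m / 2, by positivity, ?_⟩
  have := D2_near h (show 0 < m / 4 by positivity)
  filter_upwards [this] with z hz t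
  have h1 := LL_diff_le Φ Φ z q t
  have h2 := hL t
  have h3 := (abs_le.1 h1).1
  nlinarith [sq_nonneg ‖t‖]

lemma exists_quad (S : C2 →L[ℝ] C2 →L[ℝ] ℝ) (hS : ∀ v w, S v w = S w v) :
    ∃ a b c : ℂ, ∀ v : C2, (a * v.1 ^ 2 + b * (v.1 * v.2) + c * v.2 ^ 2).re =
      1 / 4 * (S v v - S (I • v) (I • v)) := by
  refine ⟨1/4 * (S (1,0) (1,0) - S (I,0) (I,0) - 2 * I * S (1,0) (I,0)),
    1/2 * (S (1,0) (0,1) - S (I,0) (0,I) - I * (S (1,0) (0,I) + S (I,0) (0,1))),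
    1/4 * (S (0,1) (0,1) - S (0,I) (0,I) - 2 * I * S (0,1) (0,I)), fun t => ?_⟩
  rw [clm_expand S t, clm_expand S (I • t)]
  simp only [add_apply, smul_apply]
  rw [clm_expand (S (1,0)) t, clm_expand (S (I,0)) t, clm_expand (S (0,1)) t, clm_expand (S (0,I)) t,
    clm_expand (S (1,0)) (I • t), clm_expand (S (I,0)) (I • t), clm_expand (S (0,1)) (I • t), clm_expand (S (0,I)) (I • t)]
  rw [hS (I,0) (1,0), hS (0,1) (1,0), hS (0,I) (1,0), hS (0,1) (I,0), hS (0,I) (I,0), hS (0,I) (0,1)]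
  simp [pow_two]
  ring

/-- quadratic polynomial -/
def QQ (a b c : ℂ) (v : C2) : ℂ := a * v.1 ^ 2 + b * (v.1 * v.2) + c * v.2 ^ 2

lemma taylor_T {Φ : C2 → ℝ} {q : C2} (h : ContDiffAt ℝ 2 Φ q) (hpos : ∀ t, t ≠ 0 → 0 < LL Φ q t) :
    ∃ a b c : ℂ, ∃ c0 > 0, ∃ ε > 0, (∀ z ∈ ball q ε, ContDiffAt ℝ 2 Φ z) ∧ ∀ x ∈ ball q ε, ∀ y ∈ ball q ε,
      Φ x + fderiv ℝ Φ x (y - x) + (QQ a b c (y - x)).re + c0 * ‖y - x‖ ^ 2 ≤ Φ y := by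
  obtain ⟨m, hm, hL⟩ := LL_lower hpos
  obtain ⟨a, b, c, hQ⟩ := exists_quad _ (symm_of_C2 h)
  obtain ⟨ε, hε, h1, h2⟩ := taylor_o h (show 0 < m / 8 by positivity)
  refine ⟨a, b, c, m / 8, by positivity, ε, hε, h1, fun x hx y hy => ?_⟩
  have h3 := (abs_le.1 (h2 x hx y hy)).1
  have h4 := hL (y - x)
  have h5 := hQ (y - x)
  unfold QQ
  rw [h5]
  unfold LL at h4
  linarith

lemma second_test {Φ : C2 → ℝ} {q : C2} (h : ContDiffAt ℝ 2 Φ q) (hmax : IsLocalMax Φ q) :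
    fderiv ℝ Φ q = 0 ∧ ∀ v, fderiv ℝ (fderiv ℝ Φ) q v v ≤ 0 := by
  have hD := hmax.fderiv_eq_zero
  refine ⟨hD, fun v => ?_⟩
  by_contra hv
  push Not at hv
  set d := fderiv ℝ (fderiv ℝ Φ) q v v with hd
  have hv0 : v ≠ 0 := by rintro rfl; simp at hd; linarith
  have hn : 0 < ‖v‖ := norm_pos_iff.2 hv0
  obtain ⟨ε, hε, h1, h2⟩ := taylor_o h (show 0 < d / (4 * ‖v‖ ^ 2) by positivity)
  have hcont : Tendsto (fun s : ℝ => q + s • v) (nhdsWithin 0 (Ioi 0)) (nhds q) := by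
    have : ContinuousAt (fun s : ℝ => q + s • v) 0 := by fun_prop
    have h3 := this.tendsto
    simp at h3
    exact h3.mono_left nhdsWithin_le_nhds
  have hev := (hcont.eventually (hmax.and (ball_mem_nhds q hε))).and self_mem_nhdsWithin
  obtain ⟨s, ⟨hs1, hs2⟩, hs3⟩ := hev.exists
  have h4 := (abs_le.1 (h2 q (mem_ball_self hε) _ hs2)).1
  rw [hD] at h4
  simp [norm_smul, ← hd] at h4
  have e : d / (4 * ‖v‖ ^ 2) * (|s| * ‖v‖) ^ 2 = d * s ^ 2 / 4 := by
    rw [mul_pow, sq_abs]; field_simp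
  rw [e] at h4
  have : 0 < s ^ 2 := by have : 0 < s := hs3; positivity
  nlinarith

lemma D2_add {f g : C2 → ℝ} {p : C2} (hf : ContDiffAt ℝ 2 f p) (hg : ContDiffAt ℝ 2 g p) :
    fderiv ℝ (fderiv ℝ (fun z => f z + g z)) p = fderiv ℝ (fderiv ℝ f) p + fderiv ℝ (fderiv ℝ g) p := by
  have h : fderiv ℝ (fun z => f z + g z) =ᶠ[nhds p] (fun z => fderiv ℝ f z + fderiv ℝ g z) := by
    filter_upwards [diff_of_C2 hf, diff_of_C2 hg] with z h1 h2
    exact fderiv_fun_add h1 h2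
  rw [h.fderiv_eq]
  exact fderiv_fun_add (diff2_of_C2 hf) (diff2_of_C2 hg)

lemma D2_const_mul {f : C2 → ℝ} {p : C2} (hf : ContDiffAt ℝ 2 f p) (c : ℝ) :
    fderiv ℝ (fderiv ℝ (fun z => c * f z)) p = c • fderiv ℝ (fderiv ℝ f) p := by
  have h : fderiv ℝ (fun z => c * f z) =ᶠ[nhds p] (fun z => c • fderiv ℝ f z) := by
    filter_upwards [diff_of_C2 hf] with z h1
    exact fderiv_const_mul h1 c
  rw [h.fderiv_eq]
  exact fderiv_fun_const_smul (diff2_of_C2 hf) c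

lemma D2_affine (l : C2 →L[ℝ] ℝ) (q : C2) (p : C2) :
    fderiv ℝ (fderiv ℝ (fun z => l (z - q))) p = 0 := by
  have h : fderiv ℝ (fun z => l (z - q)) = fun _ => l := by
    ext1 z
    have := l.hasFDerivAt.comp z ((hasFDerivAt_id z).sub_const q)
    exact this.fderiv
  rw [h]; simp

lemma LL_add {f g : C2 → ℝ} {p : C2} (hf : ContDiffAt ℝ 2 f p) (hg : ContDiffAt ℝ 2 g p) (t : C2) :
    LL (fun z => f z + g z) p t = LL f p t + LL g p t := by
  unfold LL; rw [D2_add hf hg]; simp; ring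

lemma LL_const_mul {f : C2 → ℝ} {p : C2} (hf : ContDiffAt ℝ 2 f p) (c : ℝ) (t : C2) :
    LL (fun z => c * f z) p t = c * LL f p t := by
  unfold LL; rw [D2_const_mul hf]; simp; ring

lemma LL_affine (l : C2 →L[ℝ] ℝ) (q : C2) (p t : C2) : LL (fun z => l (z - q)) p t = 0 := by
  unfold LL; rw [D2_affine]; simp

lemma D1_scomp {g : C2 → ℝ} {p : C2} (hg : DifferentiableAt ℝ g p) {χ χ' : ℝ → ℝ}
    (h1 : ∀ x, HasDerivAt χ (χ' x) x) : fderiv ℝ (fun z => χ (g z)) p = χ' (g p) • fderiv ℝ g p :=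
  ((h1 (g p)).comp_hasFDerivAt p hg.hasFDerivAt).fderiv

lemma D2_scomp {g : C2 → ℝ} {p : C2} (hg : ContDiffAt ℝ 2 g p) {χ χ' χ'' : ℝ → ℝ}
    (h1 : ∀ x, HasDerivAt χ (χ' x) x) (h2 : ∀ x, HasDerivAt χ' (χ'' x) x) (v w : C2) :
    fderiv ℝ (fderiv ℝ (fun z => χ (g z))) p v w =
      χ' (g p) * fderiv ℝ (fderiv ℝ g) p v w + χ'' (g p) * (fderiv ℝ g p v * fderiv ℝ g p w) := by
  have h : fderiv ℝ (fun z => χ (g z)) =ᶠ[nhds p] (fun z => χ' (g z) • fderiv ℝ g z) := by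
    filter_upwards [diff_of_C2 hg] with z h3
    exact D1_scomp h3 h1
  rw [h.fderiv_eq]
  have h4 := (h2 (g p)).comp_hasFDerivAt p (diff_of_C2 hg).self_of_nhds.hasFDerivAt
  have h5 := h4.smul (diff2_of_C2 hg).hasFDerivAt
  have h6 : fderiv ℝ (fun z => χ' (g z) • fderiv ℝ g z) p = _ := h5.fderiv
  rw [h6]
  simp
  ring

lemma LL_scomp {g : C2 → ℝ} {p : C2} (hg : ContDiffAt ℝ 2 g p) {χ χ' χ'' : ℝ → ℝ}
    (h1 : ∀ x, HasDerivAt χ (χ' x) x) (h2 : ∀ x, HasDerivAt χ' (χ'' x) x) (t : C2) :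
    LL (fun z => χ (g z)) p t = χ' (g p) * LL g p t +
      χ'' (g p) * (fderiv ℝ g p t ^ 2 + fderiv ℝ g p (I • t) ^ 2) := by
  unfold LL
  rw [D2_scomp hg h1 h2, D2_scomp hg h1 h2]
  ring

lemma LL_sq {g : C2 → ℝ} {p : C2} (hg : ContDiffAt ℝ 2 g p) (t : C2) :
    LL (fun z => g z ^ 2) p t = 2 * g p * LL g p t +
      2 * (fderiv ℝ g p t ^ 2 + fderiv ℝ g p (I • t) ^ 2) :=
  LL_scomp hg (χ := fun x => x ^ 2) (χ' := fun x => 2 * x) (χ'' := fun _ => 2)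
    (fun x => by simpa using hasDerivAt_pow 2 x)
    (fun x => by simpa using (hasDerivAt_id x).const_mul 2) t

/-- Euclidean norm squared -/
def esq (z : C2) : ℝ := (z.1.re ^ 2 + z.1.im ^ 2) + (z.2.re ^ 2 + z.2.im ^ 2)

lemma esq_ge (z : C2) : ‖z‖ ^ 2 ≤ esq z := by
  have h1 : ‖z.1‖ ^ 2 = z.1.re ^ 2 + z.1.im ^ 2 := by rw [Complex.sq_norm, normSq_apply]; ring
  have h2 : ‖z.2‖ ^ 2 = z.2.re ^ 2 + z.2.im ^ 2 := by rw [Complex.sq_norm, normSq_apply]; ring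
  have h3 : ‖z‖ = max ‖z.1‖ ‖z.2‖ := rfl
  unfold esq
  rw [h3, ← h1, ← h2]
  rcases max_cases ‖z.1‖ ‖z.2‖ with h | h <;> rw [h.1] <;> nlinarith [sq_nonneg ‖z.1‖, sq_nonneg ‖z.2‖]

lemma esq_le (z : C2) : esq z ≤ 2 * ‖z‖ ^ 2 := by
  have h1 : ‖z.1‖ ^ 2 = z.1.re ^ 2 + z.1.im ^ 2 := by rw [Complex.sq_norm, normSq_apply]; ring
  have h2 : ‖z.2‖ ^ 2 = z.2.re ^ 2 + z.2.im ^ 2 := by rw [Complex.sq_norm, normSq_apply]; ring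
  have h3 : ‖z.1‖ ≤ ‖z‖ := norm_fst_le z
  have h4 : ‖z.2‖ ≤ ‖z‖ := norm_snd_le z
  unfold esq
  rw [← h1, ← h2]
  nlinarith [norm_nonneg z.1, norm_nonneg z.2]

lemma esq_contDiff (q : C2) {n : WithTop ℕ∞} : ContDiff ℝ n (fun z => esq (z - q)) := by
  unfold esq
  have h : ContDiff ℝ n (fun z : C2 => z - q) := contDiff_id.sub contDiff_const
  have h1 : ContDiff ℝ n (fun z : C2 => (z - q).1.re) := reCLM.contDiff.comp h.fst
  have h2 : ContDiff ℝ n (fun z : C2 => (z - q).1.im) := imCLM.contDiff.comp h.fst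
  have h3 : ContDiff ℝ n (fun z : C2 => (z - q).2.re) := reCLM.contDiff.comp h.snd
  have h4 : ContDiff ℝ n (fun z : C2 => (z - q).2.im) := imCLM.contDiff.comp h.snd
  exact ((h1.pow 2).add (h2.pow 2)).add ((h3.pow 2).add (h4.pow 2))

lemma LL_lin_sq (l : C2 →L[ℝ] ℝ) (q p t : C2) :
    ContDiff ℝ 2 (fun z => l (z - q) ^ 2) ∧
    LL (fun z => l (z - q) ^ 2) p t = 2 * (l t ^ 2 + l (I • t) ^ 2) := by
  have h : ContDiff ℝ 2 (fun z : C2 => l (z - q)) := l.contDiff.comp (contDiff_id.sub contDiff_const)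
  refine ⟨h.pow 2, ?_⟩
  rw [LL_sq h.contDiffAt, LL_affine]
  have := l.hasFDerivAt.comp p ((hasFDerivAt_id p).sub_const q)
  have h2 : fderiv ℝ (fun z => l (z - q)) p = l := this.fderiv
  rw [h2]; ring

lemma LL_esq (q p t : C2) : LL (fun z => esq (z - q)) p t = 4 * esq t := by
  obtain ⟨c1, e1⟩ := LL_lin_sq (reCLM.comp (ContinuousLinearMap.fst ℝ ℂ ℂ)) q p t
  obtain ⟨c2, e2⟩ := LL_lin_sq (imCLM.comp (ContinuousLinearMap.fst ℝ ℂ ℂ)) q p t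
  obtain ⟨c3, e3⟩ := LL_lin_sq (reCLM.comp (ContinuousLinearMap.snd ℝ ℂ ℂ)) q p t
  obtain ⟨c4, e4⟩ := LL_lin_sq (imCLM.comp (ContinuousLinearMap.snd ℝ ℂ ℂ)) q p t
  have h := LL_add (c1.add c2).contDiffAt (c3.add c4).contDiffAt (p := p) t
  rw [LL_add c1.contDiffAt c2.contDiffAt, LL_add c3.contDiffAt c4.contDiffAt, e1, e2, e3, e4] at h
  have h' : LL (fun z => esq (z - q)) p t = _ := h
  rw [h']
  simp [esq]
  ring

lemma fderiv_esq_self (p : C2) : fderiv ℝ (fun z => esq (z - p)) p = 0 := by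
  have : IsLocalMin (fun z => esq (z - p)) p := by
    refine Filter.Eventually.of_forall fun z => ?_
    have h : esq (p - p) = 0 := by simp [esq]
    show esq (p - p) ≤ esq (z - p)
    rw [h]; unfold esq; positivity
  exact this.fderiv_eq_zero

lemma LL_re_hol {g : C2 → ℂ} {z : C2} (hg : ContDiffAt ℂ 2 g z) (t : C2) :
    LL (fun x => (g x).re) z t = 0 := by
  have h1 : ContDiffAt ℂ 2 (fun x => (g x, (0:ℂ))) z := hg.prodMk contDiffAt_const
  have h2 : ContDiff ℝ 2 (fun w : C2 => (reCLM.comp (ContinuousLinearMap.fst ℝ ℂ ℂ)) (w - 0)) :=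
    (reCLM.comp (ContinuousLinearMap.fst ℝ ℂ ℂ)).contDiff.comp (contDiff_id.sub contDiff_const)
  have h3 := LL_comp h1 (h2.contDiffAt) t
  rw [LL_affine] at h3
  rw [← h3]
  congr 1
  ext x
  simp

/-- complex-linear extension of a real functional -/
def AA (l : C2 →L[ℝ] ℝ) : C2 →L[ℂ] ℂ :=
  ((l (1, 0) : ℂ) - I * (l (I, 0) : ℂ)) • ContinuousLinearMap.fst ℂ ℂ ℂ +
  ((l (0, 1) : ℂ) - I * (l (0, I) : ℂ)) • ContinuousLinearMap.snd ℂ ℂ ℂ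

lemma AA_re (l : C2 →L[ℝ] ℝ) (t : C2) : (AA l t).re = l t := by
  rw [clm_expand l t]
  simp [AA]; ring

lemma AA_im (l : C2 →L[ℝ] ℝ) (t : C2) : (AA l t).im = - l (I • t) := by
  rw [clm_expand l (I • t)]
  simp [AA]; ring

lemma AA_eq_zero_iff (l : C2 →L[ℝ] ℝ) (t : C2) : AA l t = 0 ↔ l t = 0 ∧ l (I • t) = 0 := by
  rw [Complex.ext_iff, AA_re, AA_im]; simp

lemma AA_ne {l : C2 →L[ℝ] ℝ} (h : l ≠ 0) : AA l ≠ 0 := by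
  intro h0
  apply h
  refine ContinuousLinearMap.ext fun t => ?_
  rw [← AA_re, h0]; simp

lemma exists_one {A : C2 →L[ℂ] ℂ} (h : A ≠ 0) : ∃ v, A v = 1 := by
  obtain ⟨w, hw⟩ : ∃ w, A w ≠ 0 := by
    by_contra hh; push Not at hh; exact h (ContinuousLinearMap.ext hh)
  exact ⟨(A w)⁻¹ • w, by simp [hw]⟩

lemma exists_ker (A : C2 →L[ℂ] ℂ) : ∃ t, t ≠ 0 ∧ A t = 0 := by
  by_cases h : A (0, 1) = 0
  · exact ⟨(0, 1), by simp, h⟩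
  · refine ⟨(A (0, 1), - A (1, 0)), fun h2 => h (by simpa using congrArg Prod.fst h2), ?_⟩
    rw [clm_coord A]; simp; ring

lemma ker_one_dim {A : C2 →L[ℂ] ℂ} (hA : A ≠ 0) {s t : C2} (hs : s ≠ 0) (h1 : A s = 0) (h2 : A t = 0) :
    ∃ c : ℂ, t = c • s := by
  rw [clm_coord A] at h1 h2
  simp at h1 h2
  set a := A (1, 0) with ha
  set b := A (0, 1) with hb
  have hab : a ≠ 0 ∨ b ≠ 0 := by
    by_contra hh; push Not at hh
    apply hA; rw [clm_coord A, ← ha, ← hb, hh.1, hh.2]; simp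
  have hdet : s.1 * t.2 = s.2 * t.1 := by
    rcases hab with h | h
    · apply mul_left_cancel₀ h; linear_combination t.2 * h1 - s.2 * h2
    · apply mul_left_cancel₀ h; linear_combination s.1 * h2 - t.1 * h1
  by_cases hs1 : s.1 = 0
  · have hs2 : s.2 ≠ 0 := fun h => hs (Prod.ext hs1 h)
    refine ⟨t.2 / s.2, Prod.ext ?_ ?_⟩
    · simp [hs1] at hdet ⊢; rcases hdet with h | h
      · exact absurd h hs2
      · exact h
    · simp; field_simp
  · refine ⟨t.1 / s.1, Prod.ext ?_ ?_⟩
    · simp; field_simp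
    · simp; field_simp; linear_combination hdet

lemma LL_smul_complex (Φ : C2 → ℝ) (q t : C2) (h : ContDiffAt ℝ 2 Φ q) (c : ℂ) : LL Φ q (c • t) = ‖c‖ ^ 2 * LL Φ q t := by
  have e1 : c • t = c.re • t + c.im • (I • t) := by
    apply Prod.ext <;> apply Complex.ext <;> simp <;> ring
  have e2 : I • (c • t) = c.re • (I • t) - c.im • t := by
    apply Prod.ext <;> apply Complex.ext <;> simp <;> ring
  unfold LL
  rw [e2, e1]
  have hs := symm_of_C2 h t (I • t)
  simp only [map_add, map_sub, map_smul, add_apply, sub_apply, smul_apply, smul_eq_mul]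
  rw [hs, Complex.sq_norm, normSq_apply]
  ring

/-- make strictly psh -/
lemma make_spsh {r : C2 → ℝ} {p : C2} (h : ContDiffAt ℝ 2 r p) (hp : r p = 0)
    (hpos : ∀ t, t ≠ 0 → fderiv ℝ r p t = 0 → fderiv ℝ r p (I • t) = 0 → 0 < LL r p t) :
    ∃ N > 0, ∀ t, t ≠ 0 → 0 < LL (fun z => r z + N * r z ^ 2) p t := by
  set A := AA (fderiv ℝ r p) with hA
  have hform : ∀ N t, LL (fun z => r z + N * r z ^ 2) p t = LL r p t + 2 * N * ‖A t‖ ^ 2 := by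
    intro N t
    have h2 : ContDiffAt ℝ 2 (fun z => r z ^ 2) p := h.pow 2
    rw [LL_add h (contDiffAt_const.mul h2), LL_const_mul h2, LL_sq h, hp, Complex.sq_norm, normSq_apply, hA, AA_re, AA_im]
    ring
  have hc : Continuous (fun t => LL r p t) := by
    unfold LL
    fun_prop
  -- compactness on the sphere
  have hcomp := isCompact_sphere (0 : C2) 1
  have : ∃ n : ℕ, ∀ t ∈ sphere (0 : C2) 1, 0 < LL r p t + 2 * (n + 1 : ℝ) * ‖A t‖ ^ 2 := by
    by_contra hcon
    push Not at hcon
    choose t ht hle using hcon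
    obtain ⟨t0, ht0, φ, hφ, hlim⟩ := hcomp.tendsto_subseq ht
    have hAt : A t0 = 0 := by
      by_contra hne
      have h1 : Tendsto (fun n => ‖A (t (φ n))‖ ^ 2) atTop (nhds (‖A t0‖ ^ 2)) :=
        ((A.continuous.norm.pow 2).tendsto t0).comp hlim
      have h2 : Tendsto (fun n => LL r p (t (φ n))) atTop (nhds (LL r p t0)) := (hc.tendsto t0).comp hlim
      have h3 : Tendsto (fun n => 2 * ((φ n : ℝ) + 1)) atTop atTop := by
        have : Tendsto (fun n => (φ n : ℝ)) atTop atTop := tendsto_natCast_atTop_atTop.comp hφ.tendsto_atTop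
        exact (tendsto_atTop_add_const_right _ _ this).const_mul_atTop (by norm_num)
      have h4 := h2.add_atTop (h3.atTop_mul_pos (by positivity) h1)
      obtain ⟨n, hn⟩ := (h4.eventually_gt_atTop 0).exists
      have := hle (φ n)
      linarith
    have ht00 : t0 ≠ 0 := by rintro rfl; simp at ht0
    have h5 := (AA_eq_zero_iff _ _).1 hAt
    have h6 := hpos t0 ht00 h5.1 h5.2
    have h2 : Tendsto (fun n => LL r p (t (φ n))) atTop (nhds (LL r p t0)) := (hc.tendsto t0).comp hlim
    obtain ⟨n, hn⟩ := (h2.eventually_const_lt h6).exists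
    have h7 := hle (φ n)
    have h8 : 0 ≤ 2 * ((φ n : ℝ) + 1) * ‖A (t (φ n))‖ ^ 2 := by positivity
    linarith
  obtain ⟨n, hn⟩ := this
  refine ⟨n + 1, by positivity, fun t ht => ?_⟩
  have hnt : 0 < ‖t‖ := norm_pos_iff.2 ht
  have h1 := hn ((‖t‖⁻¹ : ℝ) • t) (by simp [norm_smul, hnt.ne'])
  rw [← hform, LL_smul_real] at h1
  exact pos_of_mul_pos_right h1 (by positivity)

lemma disc_push {Z : ℝ → ℂ → C2} {G : C2 → ℂ} {B : Set C2} (hB : IsOpen B) (hG : DifferentiableOn ℂ G B)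
    {e : ℝ} (he : 0 < e) (hZc : Continuous (fun x : ℝ × ℂ => Z x.1 x.2))
    (hZd : ∀ τ, Differentiable ℂ (Z τ))
    (hZB : ∀ τ η, 0 ≤ τ → τ ≤ e → ‖η‖ ≤ e → Z τ η ∈ B)
    (hZn : ∀ τ η, 0 ≤ τ → τ ≤ e → ‖η‖ ≤ e → (0 < τ ∨ η ≠ 0) → G (Z τ η) ≠ 0) :
    G (Z 0 0) ≠ 0 := by
  intro h0
  have hK : IsCompact (Icc (0:ℝ) e ×ˢ sphere (0:ℂ) e) := isCompact_Icc.prod (isCompact_sphere 0 e)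
  have hmaps : MapsTo (fun x : ℝ × ℂ => Z x.1 x.2) (Icc (0:ℝ) e ×ˢ sphere (0:ℂ) e) B := by
    rintro ⟨τ, η⟩ ⟨h1, h2⟩
    simp at h1 h2
    exact hZB τ η h1.1 h1.2 h2.le
  have hcont : ContinuousOn (fun x : ℝ × ℂ => ‖G (Z x.1 x.2)‖) (Icc (0:ℝ) e ×ˢ sphere (0:ℂ) e) :=
    (hG.continuousOn.comp hZc.continuousOn hmaps).norm
  have hne : (Icc (0:ℝ) e ×ˢ sphere (0:ℂ) e).Nonempty := ⟨(0, (e:ℂ)), by simp [he.le]⟩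
  obtain ⟨⟨τ0, η0⟩, hmem, hmin⟩ := hK.exists_isMinOn hne hcont
  set c := ‖G (Z τ0 η0)‖ with hc
  have hcpos : 0 < c := by
    simp at hmem
    refine norm_pos_iff.2 (hZn τ0 η0 hmem.1.1 hmem.1.2 hmem.2.le (Or.inr ?_))
    rintro rfl; simp at hmem; linarith
  have hlow : ∀ τ, 0 < τ → τ ≤ e → c ≤ ‖G (Z τ 0)‖ := by
    intro τ h1 h2
    have hnz : ∀ η, ‖η‖ ≤ e → G (Z τ η) ≠ 0 := fun η hη => hZn τ η h1.le h2 hη (Or.inl h1)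
    have hd : ∀ η, ‖η‖ ≤ e → DifferentiableAt ℂ (fun η => (G (Z τ η))⁻¹) η := by
      intro η hη
      have : DifferentiableAt ℂ G (Z τ η) := hG.differentiableAt (hB.mem_nhds (hZB τ η h1.le h2 hη))
      exact (this.comp η (hZd τ η)).inv (hnz η hη)
    have hdc : DiffContOnCl ℂ (fun η => (G (Z τ η))⁻¹) (ball 0 e) := by
      refine DifferentiableOn.diffContOnCl fun η hη => (hd η ?_).differentiableWithinAt
      rw [closure_ball _ he.ne'] at hη
      simpa using hη
    have := Complex.norm_le_of_forall_mem_frontier_norm_le (C := c⁻¹) isBounded_ball hdc (fun η hη => by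
      rw [frontier_ball _ he.ne'] at hη
      rw [norm_inv]
      apply inv_anti₀ hcpos
      exact hmin (a := (τ, η)) ⟨⟨h1.le, h2⟩, hη⟩) (subset_closure (mem_ball_self he))
    rw [norm_inv] at this
    exact (inv_le_inv₀ (norm_pos_iff.2 (hnz 0 (by simpa using he.le))) hcpos).1 this
  have hlim : Tendsto (fun τ => ‖G (Z τ 0)‖) (nhdsWithin 0 (Ioi 0)) (nhds 0) := by
    have h1 : ContinuousAt G (Z 0 0) :=
      (hG.differentiableAt (hB.mem_nhds (hZB 0 0 le_rfl he.le (by simpa using he.le)))).continuousAt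
    have h2 : ContinuousAt (fun τ => Z τ 0) 0 := by
      have : Continuous (fun τ : ℝ => Z τ 0) := hZc.comp (by fun_prop : Continuous (fun τ : ℝ => (τ, (0:ℂ))))
      exact this.continuousAt
    have h3 := (ContinuousAt.comp (f := fun τ => Z τ 0) (x := (0:ℝ)) h1 h2).norm.tendsto
    simp [h0] at h3
    exact h3.mono_left nhdsWithin_le_nhds
  have hev : ∀ᶠ τ in nhdsWithin (0:ℝ) (Ioi 0), c ≤ ‖G (Z τ 0)‖ := by
    have : Ioo (0:ℝ) e ∈ nhdsWithin (0:ℝ) (Ioi 0) := Ioo_mem_nhdsGT he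
    filter_upwards [this] with τ hτ using hlow τ hτ.1 hτ.2.le
  have := ge_of_tendsto hlim hev
  linarith

set_option maxHeartbeats 1000000 in
lemma core {Φ : C2 → ℝ} {q : C2} (h : ContDiffAt ℝ 2 Φ q) (hpos : ∀ t, t ≠ 0 → 0 < LL Φ q t)
    (hD : fderiv ℝ Φ q ≠ 0) {G : C2 → ℂ} {U : Set C2} (hU : IsOpen U) (hqU : q ∈ U)
    (hG : DifferentiableOn ℂ G U) (hGq : G q = 0) (hmax : ∀ᶠ z in nhds q, G z = 0 → Φ z ≤ Φ q) : False := by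
  obtain ⟨a, b, c, c0, hc0, ε1, hε1, -, hT⟩ := taylor_T h hpos
  have hUe : ∀ᶠ z in nhds q, z ∈ U := hU.mem_nhds hqU
  have hBe : ∀ᶠ z in nhds q, z ∈ ball q ε1 := ball_mem_nhds q hε1
  obtain ⟨ε2, hε2, hb2⟩ := Metric.eventually_nhds_iff_ball.1
    (hmax.and (hUe.and hBe))
  set A := AA (fderiv ℝ Φ q) with hA
  obtain ⟨v, hv⟩ := exists_one (AA_ne hD)
  obtain ⟨t, ht0, ht⟩ := exists_ker A
  rw [← hA] at hv
  set κ := QQ a b c t with hκ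
  set P := 2 * a * t.1 * v.1 + b * (t.1 * v.2 + t.2 * v.1) + 2 * c * t.2 * v.2 with hP
  set R := QQ a b c v with hR
  have hTp : 0 < ‖t‖ := norm_pos_iff.2 ht0
  have hQd : ∀ η σ : ℂ, QQ a b c (η • t + σ • v) = η ^ 2 * κ + σ * (η * P + σ * R) := by
    intro η σ; simp [QQ, hκ, hP, hR]; ring
  obtain ⟨K, hK1, hKκ, hKP, hKR⟩ : ∃ K : ℝ, 1 ≤ K ∧ ‖κ‖ ≤ K ∧ ‖P‖ ≤ K ∧ ‖R‖ ≤ K :=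
    ⟨1 + ‖κ‖ + ‖P‖ + ‖R‖, by have := norm_nonneg κ; have := norm_nonneg P; have := norm_nonneg R; linarith,
      by have := norm_nonneg κ; have := norm_nonneg P; have := norm_nonneg R; linarith,
      by have := norm_nonneg κ; have := norm_nonneg P; have := norm_nonneg R; linarith,
      by have := norm_nonneg κ; have := norm_nonneg P; have := norm_nonneg R; linarith⟩
  set J := K + c0 * ‖v‖ ^ 2 with hJ
  have hJ1 : 1 ≤ J := by have : 0 ≤ c0 * ‖v‖ ^ 2 := by positivity
                         linarith
  -- choose e
  have hev : ∀ᶠ e in nhdsWithin (0:ℝ) (Ioi 0), e ≤ 1 ∧ J * (e * (2 + K)) < 1 ∧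
      K * (J * (e * (2 + K))) < c0 * ‖t‖ ^ 2 / 2 ∧ e * ‖t‖ + (e * (2 + K)) * ‖v‖ < ε2 := by
    apply nhdsWithin_le_nhds
    have h1 : ContinuousAt (fun e : ℝ => e) 0 := by fun_prop
    have h2 : ContinuousAt (fun e : ℝ => J * (e * (2 + K))) 0 := by fun_prop
    have h3 : ContinuousAt (fun e : ℝ => K * (J * (e * (2 + K)))) 0 := by fun_prop
    have h4 : ContinuousAt (fun e : ℝ => e * ‖t‖ + (e * (2 + K)) * ‖v‖) 0 := by fun_prop
    filter_upwards [h1.eventually_lt (g := fun _ => (1:ℝ)) continuousAt_const (by norm_num),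
      h2.eventually_lt (g := fun _ => (1:ℝ)) continuousAt_const (by norm_num),
      h3.eventually_lt (g := fun _ => c0 * ‖t‖ ^ 2 / 2) continuousAt_const (by simp; positivity),
      h4.eventually_lt (g := fun _ => ε2) continuousAt_const (by simpa using hε2)] with e h1 h2 h3 h4
    exact ⟨h1.le, h2, h3, h4⟩
  obtain ⟨e, ⟨he1, hee1, hee2, hee3⟩, he⟩ := (hev.and self_mem_nhdsWithin).exists
  have he : 0 < e := he
  set e' := e * (2 + K) with he'
  have hσ : ∀ (τ : ℝ) (η : ℂ), 0 ≤ τ → ‖(τ : ℂ) - κ * η ^ 2‖ ≤ τ + K * ‖η‖ ^ 2 := by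
    intro τ η hτ
    calc _ ≤ ‖(τ : ℂ)‖ + ‖κ * η ^ 2‖ := norm_sub_le _ _
      _ ≤ _ := by
        rw [norm_mul, norm_pow, Complex.norm_real, Real.norm_of_nonneg hτ]
        gcongr
  have hσ2 : ∀ (τ : ℝ) (η : ℂ), 0 ≤ τ → τ ≤ e → ‖η‖ ≤ e → ‖η‖ + ‖(τ : ℂ) - κ * η ^ 2‖ ≤ e' := by
    intro τ η hτ hτe hη
    have h1 := hσ τ η hτ
    have h2 : ‖η‖ ^ 2 ≤ e := by nlinarith [norm_nonneg η]
    have h3 : K * ‖η‖ ^ 2 ≤ K * e := by gcongr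
    rw [he']; nlinarith
  have hball : ∀ (τ : ℝ) (η : ℂ), 0 ≤ τ → τ ≤ e → ‖η‖ ≤ e → q + (η • t + ((τ : ℂ) - κ * η ^ 2) • v) ∈ ball q ε2 := by
    intro τ η hτ hτe hη
    rw [mem_ball, dist_eq_norm, add_sub_cancel_left]
    refine lt_of_le_of_lt (norm_add_le _ _) ?_
    rw [norm_smul, norm_smul]
    have h1 := hσ2 τ η hτ hτe hη
    have h2 : ‖(τ : ℂ) - κ * η ^ 2‖ ≤ e' := by have := norm_nonneg η; linarith
    refine lt_of_le_of_lt ?_ hee3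
    gcongr
  refine disc_push (Z := fun τ η => q + (η • t + ((τ : ℂ) - κ * η ^ 2) • v)) (B := ball q ε2) isOpen_ball
    (hG.mono fun z hz => (hb2 z hz).2.1) he (by fun_prop) (fun τ => by fun_prop) hball ?_ (by simpa using hGq)
  intro τ η hτ hτe hη hor hGz
  have hle := (hb2 _ (hball τ η hτ hτe hη)).1 hGz
  have hT1 := hT q (mem_ball_self hε1) _ (hb2 _ (hball τ η hτ hτe hη)).2.2
  rw [add_sub_cancel_left] at hT1
  set σ : ℂ := (τ : ℂ) - κ * η ^ 2 with hσdef
  rw [← AA_re, ← hA, hQd] at hT1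
  rw [map_add, map_smul, map_smul, ht, hv] at hT1
  have e1 : (η • (0:ℂ) + σ • (1:ℂ)).re + (η ^ 2 * κ + σ * (η * P + σ * R)).re = τ + (σ * (η * P + σ * R)).re := by
    rw [← add_re]
    have : η • (0:ℂ) + σ • (1:ℂ) + (η ^ 2 * κ + σ * (η * P + σ * R)) = (τ : ℂ) + σ * (η * P + σ * R) := by
      simp [hσdef]; ring
    rw [this]; simp
  have h1 := hσ τ η hτ
  have h2 := hσ2 τ η hτ hτe hη
  rw [← hσdef] at h1 h2
  have e2 : -(K * ‖σ‖ * e') ≤ (σ * (η * P + σ * R)).re := by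
    have h3 : ‖σ * (η * P + σ * R)‖ ≤ ‖σ‖ * (K * e') := by
      rw [norm_mul]
      gcongr
      calc ‖η * P + σ * R‖ ≤ ‖η‖ * ‖P‖ + ‖σ‖ * ‖R‖ := by
            refine (norm_add_le _ _).trans ?_
            rw [norm_mul, norm_mul]
        _ ≤ ‖η‖ * K + ‖σ‖ * K := by gcongr
        _ ≤ K * e' := by nlinarith
    have h4 := abs_le.1 ((abs_re_le_norm _).trans h3)
    linarith [h4.1]
  have e3 : ‖η‖ ^ 2 * ‖t‖ ^ 2 / 2 - ‖σ‖ * e' * ‖v‖ ^ 2 ≤ ‖η • t + σ • v‖ ^ 2 := by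
    have h3 : ‖η‖ * ‖t‖ ≤ ‖η • t + σ • v‖ + ‖σ‖ * ‖v‖ := by
      rw [← norm_smul, ← norm_smul]
      have := norm_sub_le (η • t + σ • v) (σ • v)
      simpa using this
    have h5 : (‖η‖ * ‖t‖) ^ 2 ≤ (‖η • t + σ • v‖ + ‖σ‖ * ‖v‖) ^ 2 := by gcongr
    have h6 : ‖σ‖ * ‖σ‖ ≤ ‖σ‖ * e' := by have := norm_nonneg η; gcongr; linarith
    have h7 : ‖σ‖ * ‖σ‖ * ‖v‖ ^ 2 ≤ ‖σ‖ * e' * ‖v‖ ^ 2 := by gcongr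
    nlinarith [sq_nonneg (‖η • t + σ • v‖ - ‖σ‖ * ‖v‖)]
  have e4 : c0 * (‖η‖ ^ 2 * ‖t‖ ^ 2 / 2 - ‖σ‖ * e' * ‖v‖ ^ 2) ≤ c0 * ‖η • t + σ • v‖ ^ 2 := by gcongr
  have e5 : ‖σ‖ * (J * e') ≤ (τ + K * ‖η‖ ^ 2) * (J * e') := by gcongr
  have e6 : τ + ‖η‖ ^ 2 * (c0 * ‖t‖ ^ 2 / 2) - ‖σ‖ * (J * e') ≤ 0 := by
    have e8 : ‖σ‖ * (J * e') = K * ‖σ‖ * e' + c0 * (‖σ‖ * e' * ‖v‖ ^ 2) := by rw [hJ]; ring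
    have e9 : c0 * (‖η‖ ^ 2 * ‖t‖ ^ 2 / 2 - ‖σ‖ * e' * ‖v‖ ^ 2) = ‖η‖ ^ 2 * (c0 * ‖t‖ ^ 2 / 2) - c0 * (‖σ‖ * e' * ‖v‖ ^ 2) := by ring
    linarith
  have e7 : τ * (1 - J * e') + ‖η‖ ^ 2 * (c0 * ‖t‖ ^ 2 / 2 - K * (J * e')) ≤ 0 := by
    have e10 : τ * (1 - J * e') + ‖η‖ ^ 2 * (c0 * ‖t‖ ^ 2 / 2 - K * (J * e')) = τ + ‖η‖ ^ 2 * (c0 * ‖t‖ ^ 2 / 2) - (τ + K * ‖η‖ ^ 2) * (J * e') := by ring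
    linarith
  rcases hor with h' | h'
  · have : 0 < τ * (1 - J * e') := mul_pos h' (by linarith)
    have : 0 ≤ ‖η‖ ^ 2 * (c0 * ‖t‖ ^ 2 / 2 - K * (J * e')) := mul_nonneg (by positivity) (by linarith)
    linarith
  · have : 0 ≤ τ * (1 - J * e') := mul_nonneg hτ (by linarith)
    have : 0 < ‖η‖ ^ 2 * (c0 * ‖t‖ ^ 2 / 2 - K * (J * e')) :=
      mul_pos (by have := norm_pos_iff.2 h'; positivity) (by linarith)
    linarith

lemma zeros_null_one {g : ℂ → ℂ} {a : ℂ} {R : ℝ} (hg : DifferentiableOn ℂ g (ball a R)) {w0 : ℂ}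
    (hw : w0 ∈ ball a R) (hne : g w0 ≠ 0) : ∀ᵐ w, w ∈ ball a R → g w ≠ 0 := by
  have han : AnalyticOnNhd ℂ g (ball a R) := hg.analyticOnNhd isOpen_ball
  rcases han.eqOn_zero_or_eventually_ne_zero_of_preconnected (convex_ball a R).isPreconnected with h | h
  · exact absurd (h hw) hne
  · have h2 := ae_restrict_le_codiscreteWithin (μ := MeasureTheory.volume) (measurableSet_ball (x := a) (ε := R)) h
    exact (MeasureTheory.ae_restrict_iff' measurableSet_ball).1 h2

lemma zeros_null {G : C2 → ℂ} {c : C2} {R : ℝ} (hG : DifferentiableOn ℂ G (ball c R)) {z0 : C2}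
    (hz : z0 ∈ ball c R) (hne : G z0 ≠ 0) : MeasureTheory.volume {z : C2 | z ∈ ball c R ∧ G z = 0} = 0 := by
  have hprod : ball c R = ball c.1 R ×ˢ ball c.2 R := by
    rw [ball_prod_same]
  have hmem : ∀ x y, (x, y) ∈ ball c R ↔ x ∈ ball c.1 R ∧ y ∈ ball c.2 R := by
    intro x y; rw [hprod]; rfl
  have hmeas : MeasurableSet {z : C2 | z ∈ ball c R ∧ G z = 0} := by
    have h1 : IsOpen (ball c R ∩ G ⁻¹' {0}ᶜ) := hG.continuousOn.isOpen_inter_preimage isOpen_ball isOpen_compl_singleton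
    have h2 : {z : C2 | z ∈ ball c R ∧ G z = 0} = ball c R \ (ball c R ∩ G ⁻¹' {0}ᶜ) := by
      ext z; simp
    rw [h2]
    exact measurableSet_ball.diff h1.measurableSet
  obtain ⟨x0, y0⟩ := z0
  have hz' := (hmem _ _).1 hz
  rw [MeasureTheory.Measure.volume_eq_prod]
  apply MeasureTheory.Measure.measure_prod_null_of_ae_null hmeas
  have hd1 : DifferentiableOn ℂ (fun x => G (x, y0)) (ball c.1 R) :=
    hG.comp (by fun_prop) (fun x hx => (hmem _ _).2 ⟨hx, hz'.2⟩)
  have h1 := zeros_null_one hd1 hz'.1 hne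
  filter_upwards [h1] with x hx
  by_cases hxb : x ∈ ball c.1 R
  · have hd2 : DifferentiableOn ℂ (fun y => G (x, y)) (ball c.2 R) :=
      hG.comp (by fun_prop) (fun y hy => (hmem _ _).2 ⟨hxb, hy⟩)
    have h2 := zeros_null_one hd2 hz'.2 (hx hxb)
    rw [MeasureTheory.ae_iff] at h2
    refine MeasureTheory.measure_mono_null ?_ h2
    rintro y ⟨hy1, hy2⟩
    have := ((hmem _ _).1 hy1).2
    simp only [mem_ofPred_eq]
    push Not
    exact ⟨this, hy2⟩
  · have : Prod.mk x ⁻¹' {z : C2 | z ∈ ball c R ∧ G z = 0} = ∅ := by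
      ext y
      simp only [mem_preimage, mem_ofPred_eq, mem_empty_iff_false, iff_false, not_and]
      intro hy
      exact absurd ((hmem _ _).1 hy).1 hxb
    rw [this]; simp

lemma gamma_diff {Φ : C2 → ℝ} {z : C2} (h : ContDiffAt ℝ 2 Φ z) :
    DifferentiableAt ℝ (fun z => ((AA (fderiv ℝ Φ z) (1, 0), AA (fderiv ℝ Φ z) (0, 1)) : C2)) z := by
  have h1 : ∀ w : C2, DifferentiableAt ℝ (fun z => AA (fderiv ℝ Φ z) w) z := by
    intro w
    have h2 : ∀ v : C2, DifferentiableAt ℝ (fun z => ((fderiv ℝ Φ z v : ℝ) : ℂ)) z := fun v => (fd_apply h v).differentiableAt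
    have e : (fun z => AA (fderiv ℝ Φ z) w) = fun z => ((fderiv ℝ Φ z w : ℝ) : ℂ) - I * ((fderiv ℝ Φ z (I • w) : ℝ) : ℂ) := by
      ext1 z
      apply Complex.ext
      · rw [AA_re]; simp
      · rw [AA_im]; simp
    rw [e]
    exact (h2 w).sub ((h2 (I • w)).const_mul I)
  exact (h1 _).prodMk (h1 _)

lemma maxp {G : C2 → ℂ} {c : C2} {R : ℝ} (hG : DifferentiableOn ℂ G (ball c R)) {X V : Set C2}
    (hX : IsCompact X) (hXB : X ⊆ ball c R) (hXG : ∀ z ∈ X, G z = 0) (hV : IsOpen V) (hVB : V ⊆ ball c R)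
    (hVX : ∀ z ∈ V, G z = 0 → z ∈ X) {Φ : C2 → ℝ} (hΦc : ContinuousOn Φ X)
    (hΦ2 : ∀ z ∈ V, ContDiffAt ℝ 2 Φ z) (hLL : ∀ z ∈ V, ∀ t, t ≠ 0 → 0 < LL Φ z t) {m : ℝ}
    (hm : ∀ z ∈ X, z ∉ V → Φ z ≤ m) : ∀ z ∈ X, Φ z ≤ m := by
  by_contra hcon
  push Not at hcon
  obtain ⟨x0, hx0, hx0m⟩ := hcon
  by_cases hG0 : ∀ z ∈ ball c R, G z = 0
  · obtain ⟨x1, hx1, hmax⟩ := hX.exists_isMaxOn ⟨x0, hx0⟩ hΦc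
    have hx1V : x1 ∈ V := by
      by_contra hh
      have h1 := hm x1 hx1 hh
      have h2 : Φ x0 ≤ Φ x1 := hmax hx0
      linarith
    have hloc : IsLocalMax Φ x1 := by
      filter_upwards [hV.mem_nhds hx1V] with z hz
      exact hmax (hVX z hz (hG0 z (hVB hz)))
    have h3 := (second_test (hΦ2 x1 hx1V) hloc).2
    have h4 := hLL x1 hx1V (1, 0) (by simp)
    unfold LL at h4
    have h5 := h3 (1, 0)
    have h6 := h3 (I • (1, 0))
    linarith
  · push Not at hG0
    obtain ⟨z0, hz0, hz0n⟩ := hG0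
    have hnull := zeros_null hG hz0 hz0n
    set γ : C2 → C2 := fun z => (AA (fderiv ℝ Φ z) (1, 0), AA (fderiv ℝ Φ z) (0, 1)) with hγ
    have hnull2 : MeasureTheory.volume (γ '' (X ∩ V)) = 0 := by
      have : (MeasureTheory.volume : MeasureTheory.Measure C2).IsAddHaarMeasure := by
        rw [MeasureTheory.Measure.volume_eq_prod]; infer_instance
      apply MeasureTheory.addHaar_image_eq_zero_of_differentiableOn_of_addHaar_eq_zero
      · intro z hz
        exact (gamma_diff (hΦ2 z hz.2)).differentiableWithinAt
      · have hsub : X ∩ V ⊆ {z : C2 | z ∈ ball c R ∧ G z = 0} := fun z hz => ⟨hXB hz.1, hXG z hz.1⟩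
        exact MeasureTheory.measure_mono_null hsub hnull
    obtain ⟨M, hM⟩ := hX.isBounded.exists_norm_le
    have hM0 : 0 ≤ M := (norm_nonneg _).trans (hM x0 hx0)
    obtain ⟨κ, hκ, hκ2⟩ : ∃ κ > 0, 4 * κ * M < Φ x0 - m := by
      refine ⟨(Φ x0 - m) / (4 * M + 1) , div_pos (by linarith) (by positivity), ?_⟩
      have : 0 < 4 * M + 1 := by positivity
      rw [← sub_pos]
      have e : Φ x0 - m - 4 * ((Φ x0 - m) / (4 * M + 1)) * M = (Φ x0 - m) / (4 * M + 1) := by field_simp; ring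
      rw [e]; exact div_pos (by linarith) this
    obtain ⟨β, hβ, hβγ⟩ : ∃ β ∈ ball (0 : C2) κ, β ∉ γ '' (X ∩ V) := by
      by_contra hh
      push Not at hh
      have h1 := MeasureTheory.measure_mono_null hh hnull2
      exact (measure_ball_pos MeasureTheory.volume (0 : C2) hκ).ne' h1
    have hβn : ‖β‖ ≤ κ := by simpa using (mem_ball_zero_iff.1 hβ).le
    set g : C2 → ℂ := fun z => -(β.1 * z.1 + β.2 * z.2) with hg
    have hgb : ∀ z ∈ X, |(g z).re| ≤ 2 * κ * M := by
      intro z hz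
      refine (abs_re_le_norm _).trans ?_
      rw [hg]
      simp only [norm_neg]
      refine (norm_add_le _ _).trans ?_
      rw [norm_mul, norm_mul]
      have h1 := (norm_fst_le β).trans hβn
      have h2 := (norm_snd_le β).trans hβn
      have h3 := (norm_fst_le z).trans (hM z hz)
      have h4 := (norm_snd_le z).trans (hM z hz)
      have : ‖β.1‖ * ‖z.1‖ ≤ κ * M := by gcongr
      have : ‖β.2‖ * ‖z.2‖ ≤ κ * M := by gcongr
      linarith
    have hgc : ContDiff ℂ 2 g := ((contDiff_const.mul contDiff_fst).add (contDiff_const.mul contDiff_snd)).neg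
    have hgr : ContDiff ℝ 2 (fun z => (g z).re) := reCLM.contDiff.comp (hgc.restrict_scalars ℝ)
    have hΨc : ContinuousOn (fun z => Φ z + (g z).re) X := hΦc.add hgr.continuous.continuousOn
    obtain ⟨x1, hx1, hmax⟩ := hX.exists_isMaxOn ⟨x0, hx0⟩ hΨc
    have hx1V : x1 ∈ V := by
      by_contra hh
      have h1 := hm x1 hx1 hh
      have h2 : Φ x0 + (g x0).re ≤ Φ x1 + (g x1).re := hmax hx0
      have h3 := abs_le.1 (hgb x0 hx0)
      have h4 := abs_le.1 (hgb x1 hx1)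
      linarith [h3.1, h4.2]
    refine core (Φ := fun z => Φ z + (g z).re) ((hΦ2 x1 hx1V).add hgr.contDiffAt) ?_ ?_ isOpen_ball (hXB hx1) hG (hXG x1 hx1) ?_
    · intro t ht
      rw [LL_add (hΦ2 x1 hx1V) hgr.contDiffAt, LL_re_hol hgc.contDiffAt]
      simpa using hLL x1 hx1V t ht
    · intro hD
      apply hβγ
      refine ⟨x1, ⟨hx1, hx1V⟩, ?_⟩
      have h1 : fderiv ℝ (fun z => (g z).re) x1 = -(reCLM.comp ((β.1 • ContinuousLinearMap.fst ℂ ℂ ℂ + β.2 • ContinuousLinearMap.snd ℂ ℂ ℂ).restrictScalars ℝ)) := by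
        have e : (fun z => (g z).re) = fun z => (-(reCLM.comp ((β.1 • ContinuousLinearMap.fst ℂ ℂ ℂ + β.2 • ContinuousLinearMap.snd ℂ ℂ ℂ).restrictScalars ℝ))) z := by
          ext z; simp [hg]
        rw [e]
        exact ContinuousLinearMap.fderiv _
      have h2 := fderiv_fun_add ((hΦ2 x1 hx1V).differentiableAt (by simp)) (hgr.contDiffAt (x := x1).differentiableAt (by simp))
      rw [h2, h1] at hD
      have h3 : fderiv ℝ Φ x1 = reCLM.comp ((β.1 • ContinuousLinearMap.fst ℂ ℂ ℂ + β.2 • ContinuousLinearMap.snd ℂ ℂ ℂ).restrictScalars ℝ) := by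
        rw [← sub_eq_add_neg] at hD
        exact sub_eq_zero.1 hD
      simp only [hγ]
      rw [h3]
      apply Prod.ext <;> apply Complex.ext
      · simp [AA_re]
      · simp [AA_im]
      · simp [AA_re]
      · simp [AA_im]
    · filter_upwards [hV.mem_nhds hx1V] with z hz hGz
      exact hmax (hVX z hz hGz)

/-- local situation -/
structure Loc (r r' : C2 → ℝ) (F : C2 → C2) (p : C2) (s m : ℝ) : Prop where
  s_pos : 0 < s
  m_pos : 0 < m
  r_cd : ∀ z ∈ ball p s, ContDiffAt ℝ 3 r z
  r_D : ∀ z ∈ ball p s, fderiv ℝ r z ≠ 0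
  r_LL : ∀ z ∈ ball p s, ∀ t, m * ‖t‖ ^ 2 ≤ LL r z t
  F_hol : DifferentiableOn ℂ F (ball p s)
  r'_cd : ∀ z ∈ ball p s, ContDiffAt ℝ 3 r' (F z)
  r'_D : ∀ z ∈ ball p s, fderiv ℝ r' (F z) ≠ 0
  neg : ∀ z ∈ ball p s, r z < 0 → r' (F z) < 0
  zero : ∀ z ∈ ball p s, r z = 0 → r' (F z) = 0
  rp : r p = 0

lemma exists_neg_near {r : C2 → ℝ} {q : C2} (hD : fderiv ℝ r q ≠ 0) (hq : r q = 0) :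
    ∃ᶠ z in nhds q, r z < 0 := by
  intro h
  apply hD
  have : IsLocalMin r q := by
    filter_upwards [h] with z hz
    rw [hq]; exact not_lt.1 hz
  exact this.fderiv_eq_zero

lemma LL_sub_esq {r : C2 → ℝ} {z : C2} (h : ContDiffAt ℝ 2 r z) (μ : ℝ) (q t : C2) :
    ContDiffAt ℝ 2 (fun z => r z + (-μ) * esq (z - q)) z ∧
    LL (fun z => r z + (-μ) * esq (z - q)) z t = LL r z t - 4 * μ * esq t := by
  have h1 : ContDiff ℝ 2 (fun z => esq (z - q)) := esq_contDiff q
  refine ⟨h.add (contDiff_const.mul h1).contDiffAt, ?_⟩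
  rw [LL_add h (contDiff_const.mul h1).contDiffAt, LL_const_mul h1.contDiffAt, LL_esq]
  ring

lemma QQ_hol {F : C2 → C2} {U : Set C2} (hF : DifferentiableOn ℂ F U) (A : C2 →L[ℂ] ℂ) (a b c : ℂ) (w0 : C2) :
    DifferentiableOn ℂ (fun z => A (F z - w0) + QQ a b c (F z - w0)) U := by
  have h1 : DifferentiableOn ℂ (fun z => F z - w0) U := hF.sub_const w0
  have h2 : DifferentiableOn ℂ (fun z => A (F z - w0)) U := A.differentiable.comp_differentiableOn h1
  unfold QQ
  exact h2.add ((((h1.fst.pow 2).const_mul a).add ((h1.fst.mul h1.snd).const_mul b)).add ((h1.snd.pow 2).const_mul c))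

lemma Loc.A {r r' : C2 → ℝ} {F : C2 → C2} {p : C2} {s m : ℝ} (H : Loc r r' F p s m) {q0 : C2}
    (hq0 : q0 ∈ ball p s) (hrq : r q0 = 0) {t : C2} (h1 : fderiv ℝ r' (F q0) t = 0)
    (h2 : fderiv ℝ r' (F q0) (I • t) = 0) : 0 ≤ LL r' (F q0) t := by
  by_contra hneg
  push Not at hneg
  have ht0 : t ≠ 0 := by rintro rfl; simp [LL] at hneg
  have hr'2 : ContDiffAt ℝ 2 r' (F q0) := (H.r'_cd q0 hq0).of_le (by norm_num)
  set R : C2 → ℝ := fun w => (-1) * r' w with hR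
  have hR2 : ContDiffAt ℝ 2 R (F q0) := contDiffAt_const.mul hr'2
  have hDR : fderiv ℝ R (F q0) = (-1 : ℝ) • fderiv ℝ r' (F q0) :=
    fderiv_const_mul (hr'2.differentiableAt (by simp)) (-1)
  have hR0 : R (F q0) = 0 := by simp [hR, H.zero q0 hq0 hrq]
  have hAne := AA_ne (H.r'_D q0 hq0)
  obtain ⟨N, hN, hρ⟩ := make_spsh hR2 hR0 (by
    intro t2 ht2 h3 h4
    rw [hDR] at h3 h4
    simp at h3 h4
    obtain ⟨c, hc⟩ := ker_one_dim hAne ht0 ((AA_eq_zero_iff _ _).2 ⟨h1, h2⟩) ((AA_eq_zero_iff _ _).2 ⟨h3, h4⟩)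
    have hc0 : c ≠ 0 := by rintro rfl; simp at hc; exact ht2 hc
    rw [LL_const_mul hr'2, hc, LL_smul_complex _ _ _ hr'2]
    have : 0 < ‖c‖ ^ 2 := by have := norm_pos_iff.2 hc0; positivity
    nlinarith)
  set ρ' : C2 → ℝ := fun z => R z + N * R z ^ 2 with hρ'
  have hρ'2 : ContDiffAt ℝ 2 ρ' (F q0) := hR2.add (contDiffAt_const.mul (hR2.pow 2))
  obtain ⟨a, b, c, c0, hc0, ε, hε, -, hT⟩ := taylor_T hρ'2 hρ
  have hFc : ContinuousAt F q0 := (H.F_hol.differentiableAt (isOpen_ball.mem_nhds hq0)).continuousAt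
  have hev : ∀ᶠ z in nhds q0, z ∈ ball p s ∧ F z ∈ ball (F q0) ε :=
    (isOpen_ball.eventually_mem hq0).and (hFc.eventually (isOpen_ball.eventually_mem (mem_ball_self hε)))
  obtain ⟨s2, hs2, hb⟩ := Metric.nhds_basis_closedBall.eventually_iff.1 hev
  set μ := m / 16 with hμ
  have hμp : 0 < μ := by have := H.m_pos; positivity
  set Φ : C2 → ℝ := fun z => r z + (-μ) * esq (z - q0) with hΦ
  have hrc : ContinuousOn r (ball p s) := fun z hz => (H.r_cd z hz).continuousAt.continuousWithinAt
  have hr2 : ∀ z ∈ ball p s, ContDiffAt ℝ 2 r z := fun z hz => (H.r_cd z hz).of_le (by norm_num)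
  have hΦ2 : ∀ z ∈ ball p s, ContDiffAt ℝ 2 Φ z := fun z hz => (LL_sub_esq (hr2 z hz) μ q0 0).1
  have hΦq : Φ q0 = 0 := by simp [hΦ, hrq, esq]
  have hΦev : ∀ᶠ z in nhds q0, -μ * s2 ^ 2 < Φ z :=
    continuousAt_const.eventually_lt (hΦ2 q0 hq0).continuousAt (by rw [hΦq]; nlinarith [sq_pos_of_pos hs2])
  obtain ⟨z0, hz0r, hz0Φ, hz0b⟩ := ((exists_neg_near (H.r_D q0 hq0) hrq).and_eventually
    (hΦev.and (isOpen_ball.eventually_mem (mem_ball_self hs2)))).exists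
  have hz0c := ball_subset_closedBall hz0b
  obtain ⟨hz0U, hz0ε⟩ := hb hz0c
  set w0 := F z0 with hw0
  have hρpos : 0 < ρ' w0 := by
    have h3 := H.neg z0 hz0U hz0r
    have h4 : 0 < R w0 := by simp only [hR]; linarith
    simp only [hρ']; positivity
  set G : C2 → ℂ := fun z => AA (fderiv ℝ ρ' w0) (F z - w0) + QQ a b c (F z - w0) with hG
  have hGd : DifferentiableOn ℂ G (ball p s) := QQ_hol H.F_hol _ a b c w0
  have hGpos : ∀ z ∈ closedBall q0 s2, G z = 0 → 0 < ρ' (F z) := by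
    intro z hz hGz
    have h3 := hT w0 hz0ε (F z) (hb hz).2
    have h4 : (G z).re = 0 := by rw [hGz]; simp
    simp only [hG, add_re, AA_re] at h4
    have : 0 ≤ c0 * ‖F z - w0‖ ^ 2 := by positivity
    linarith
  have hGne : ∀ z ∈ closedBall q0 s2, G z = 0 → r z ≠ 0 := by
    intro z hz hGz hrz
    have h3 := hGpos z hz hGz
    have h4 := H.zero z (hb hz).1 hrz
    simp [hρ', hR, h4] at h3
  have hsub : closedBall q0 s2 ⊆ ball p s := fun z hz => (hb hz).1
  have hXcl : IsClosed {z | z ∈ closedBall q0 s2 ∧ r z ≤ 0 ∧ G z = 0} := by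
    have h3 : IsClosed (closedBall q0 s2 ∩ r ⁻¹' Iic 0) :=
      (hrc.mono hsub).preimage_isClosed_of_isClosed isClosed_closedBall isClosed_Iic
    have h4 : IsClosed (closedBall q0 s2 ∩ G ⁻¹' {0}) :=
      (hGd.continuousOn.mono hsub).preimage_isClosed_of_isClosed isClosed_closedBall isClosed_singleton
    convert h3.inter h4 using 1
    ext z; simp; tauto
  have hXc : IsCompact {z | z ∈ closedBall q0 s2 ∧ r z ≤ 0 ∧ G z = 0} :=
    (isCompact_closedBall q0 s2).of_isClosed_subset hXcl (fun z hz => hz.1)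
  have hVo : IsOpen (ball q0 s2 ∩ r ⁻¹' Iio 0) :=
    (hrc.mono (ball_subset_closedBall.trans hsub)).isOpen_inter_preimage isOpen_ball isOpen_Iio
  have hfin := maxp hGd hXc (fun z hz => hsub hz.1) (fun z hz => hz.2.2) hVo
    (fun z hz => hsub (ball_subset_closedBall hz.1))
    (fun z hz hGz => ⟨ball_subset_closedBall hz.1, le_of_lt hz.2, hGz⟩) (Φ := Φ)
    (fun z hz => (hΦ2 z (hsub hz.1)).continuousAt.continuousWithinAt)
    (fun z hz => hΦ2 z (hsub (ball_subset_closedBall hz.1)))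
    (fun z hz t ht => by
      have hzU := hsub (ball_subset_closedBall hz.1)
      rw [(LL_sub_esq (hr2 z hzU) μ q0 t).2]
      have h3 := H.r_LL z hzU t
      have h4 := esq_le t
      have h5 := norm_pos_iff.2 ht
      have h6 : 4 * μ * esq t ≤ 4 * μ * (2 * ‖t‖ ^ 2) := by gcongr
      have h7 : 0 < m * ‖t‖ ^ 2 := by have := H.m_pos; positivity
      rw [hμ] at h6 ⊢
      linarith) (m := -μ * s2 ^ 2)
    (fun z hz hzV => by
      have h3 := hGne z hz.1 hz.2.2
      have h4 : r z < 0 := lt_of_le_of_ne hz.2.1 h3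
      have h5 : z ∉ ball q0 s2 := fun h => hzV ⟨h, h4⟩
      have h6 : s2 ≤ ‖z - q0‖ := by simpa [dist_eq_norm] using h5
      have h7 := esq_ge (z - q0)
      have h8 : s2 ^ 2 ≤ ‖z - q0‖ ^ 2 := by gcongr
      simp only [hΦ]
      nlinarith)
  have h9 := hfin z0 ⟨hz0c, hz0r.le, by simp [hG, ← hw0, QQ]⟩
  linarith

lemma pole_re (a : ℝ) (ζ : ℂ) (h : (a : ℂ) - ζ ≠ 0) :
    (ζ / ((a : ℂ) - ζ)).re = (a * ζ.re - (ζ.re ^ 2 + ζ.im ^ 2)) / ((a - ζ.re) ^ 2 + ζ.im ^ 2) := by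
  have h1 : normSq ((a : ℂ) - ζ) = (a - ζ.re) ^ 2 + ζ.im ^ 2 := by
    rw [normSq_apply]; simp; ring
  rw [Complex.div_re, h1, ← add_div]
  congr 1
  simp; ring

lemma pole_bd1 {δ : ℝ} (hδ : 0 < δ) {ζ : ℂ} (h : ζ.re ≤ 3 / 2 * δ) :
    (ζ / (((2 * δ : ℝ) : ℂ) - ζ)).re ≤ 3 := by
  have hne : ((2 * δ : ℝ) : ℂ) - ζ ≠ 0 := by
    intro h0
    have := congrArg Complex.re h0
    simp at this; linarith
  rw [pole_re _ _ hne]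
  have hpos : 0 < (2 * δ - ζ.re) ^ 2 + ζ.im ^ 2 := by
    have : 0 < 2 * δ - ζ.re := by linarith
    positivity
  rw [div_le_iff₀ hpos]
  nlinarith [sq_nonneg ζ.im, mul_nonneg (by linarith : 0 ≤ 3 / 2 * δ - ζ.re) (by linarith : 0 ≤ 3 / 2 * δ - ζ.re), mul_nonneg hδ.le (by linarith : 0 ≤ 3 / 2 * δ - ζ.re)]

lemma pole_bd2 {δ : ℝ} (hδ : 0 < δ) {ζ : ℂ} (h : ζ.re ≤ 3 / 2 * δ) (hn : ‖ζ‖ = 3 * δ) :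
    (ζ / (((2 * δ : ℝ) : ℂ) - ζ)).re ≤ -(1 / 5) := by
  have hne : ((2 * δ : ℝ) : ℂ) - ζ ≠ 0 := by
    intro h0
    have := congrArg Complex.re h0
    simp at this; linarith
  rw [pole_re _ _ hne]
  have hpos : 0 < (2 * δ - ζ.re) ^ 2 + ζ.im ^ 2 := by
    have : 0 < 2 * δ - ζ.re := by linarith
    positivity
  have h2 : ζ.re ^ 2 + ζ.im ^ 2 = 9 * δ ^ 2 := by
    have : ‖ζ‖ ^ 2 = ζ.re ^ 2 + ζ.im ^ 2 := by rw [Complex.sq_norm, normSq_apply]; ring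
    rw [← this, hn]; ring
  rw [div_le_iff₀ hpos]
  nlinarith [mul_nonneg hδ.le (by linarith : 0 ≤ 3 / 2 * δ - ζ.re), sq_nonneg δ]

lemma det_zero {n w : C2} (hn : n ≠ 0) (h : w.1 * n.2 - w.2 * n.1 = 0) : ∃ c : ℂ, w = c • n := by
  by_cases h1 : n.1 = 0
  · have h2 : n.2 ≠ 0 := fun h => hn (Prod.ext h1 h)
    refine ⟨w.2 / n.2, Prod.ext ?_ ?_⟩
    · simp [h1] at h ⊢; rcases h with h | h
      · exact h
      · exact absurd h h2
    · simp; field_simp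
  · refine ⟨w.1 / n.1, Prod.ext ?_ ?_⟩
    · simp; field_simp
    · simp; field_simp; linear_combination -h

lemma Loc.near {r r' : C2 → ℝ} {F : C2 → C2} {p : C2} {s m : ℝ} (H : Loc r r' F p s m) :
    ∃ C > 0, ∀ᶠ z0 in nhds p, r z0 < 0 → ∃ q ∈ ball p s, r q = 0 ∧ ‖F q - F z0‖ ≤ C * (-r' (F z0)) := by
  have hpU : p ∈ ball p s := mem_ball_self H.s_pos
  have hr'2 : ContDiffAt ℝ 2 r' (F p) := (H.r'_cd p hpU).of_le (by norm_num)
  have hFc : ContinuousAt F p := (H.F_hol.differentiableAt (isOpen_ball.mem_nhds hpU)).continuousAt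
  obtain ⟨v, hv⟩ := exists_one (AA_ne (H.r'_D p hpU))
  have hv0 : v ≠ 0 := by rintro rfl; simp at hv
  have hvn := norm_pos_iff.2 hv0
  obtain ⟨ε, hε, -, hT⟩ := taylor_o hr'2 one_pos
  set C2' := ‖fderiv ℝ (fderiv ℝ r') (F p)‖ + 1 with hC2
  have hC2p : 0 < C2' := by positivity
  have hTlow : ∀ x ∈ ball (F p) ε, ∀ y ∈ ball (F p) ε,
      r' x + fderiv ℝ r' x (y - x) - C2' * ‖y - x‖ ^ 2 ≤ r' y := by
    intro x hx y hy
    have h1 := (abs_le.1 (hT x hx y hy)).1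
    have h2 := (fderiv ℝ (fderiv ℝ r') (F p)).le_opNorm₂ (y - x) (y - x)
    have h3 := (abs_le.1 h2).1
    have : 0 ≤ ‖fderiv ℝ (fderiv ℝ r') (F p)‖ * ‖y - x‖ ^ 2 := by positivity
    rw [hC2]; nlinarith
  have hev : ∀ᶠ z in nhds p, z ∈ ball p s ∧ F z ∈ ball (F p) ε :=
    (isOpen_ball.eventually_mem hpU).and (hFc.eventually (isOpen_ball.eventually_mem (mem_ball_self hε)))
  obtain ⟨s2, hs2, hb⟩ := Metric.nhds_basis_closedBall.eventually_iff.1 hev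
  have hsub : closedBall p s2 ⊆ ball p s := fun z hz => (hb hz).1
  set μ := m / 16 with hμ
  have hμp : 0 < μ := by have := H.m_pos; positivity
  set K := μ * s2 ^ 2 / 6 with hK
  have hKp : 0 < K := by positivity
  have hrc : ContinuousOn r (ball p s) := fun z hz => (H.r_cd z hz).continuousAt.continuousWithinAt
  have hr2 : ∀ z ∈ ball p s, ContDiffAt ℝ 2 r z := fun z hz => (H.r_cd z hz).of_le (by norm_num)
  have hΦ02 : ∀ z ∈ ball p s, ContDiffAt ℝ 2 (fun z => r z + (-μ) * esq (z - p)) z := fun z hz => (LL_sub_esq (hr2 z hz) μ p 0).1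
  refine ⟨6 * ‖v‖, by positivity, ?_⟩
  have ev1 : ∀ᶠ z in nhds p, -(K / 5) < r z + (-μ) * esq (z - p) :=
    continuousAt_const.eventually_lt (hΦ02 p hpU).continuousAt (by
      have : r p + (-μ) * esq (p - p) = 0 := by simp [H.rp, esq]
      rw [this]; linarith)
  have hu0 : r' (F p) = 0 := H.zero p hpU H.rp
  have hcu : ContinuousAt (fun z => C2' * (36 * ‖v‖ ^ 2) * (-r' (F z))) p :=
    continuousAt_const.mul (ContinuousAt.comp hr'2.continuousAt hFc).neg
  have ev2 : ∀ᶠ z in nhds p, C2' * (36 * ‖v‖ ^ 2) * (-r' (F z)) < 1 / 2 :=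
    hcu.eventually_lt continuousAt_const (by rw [hu0]; norm_num)
  have ev3 : ∀ᶠ z in nhds p, 1 / 2 < fderiv ℝ r' (F z) v := by
    have h1 : ContinuousAt (fun z => fderiv ℝ r' (F z) v) p :=
      (ContinuousAt.comp (f := F) (g := fderiv ℝ r') (contAt_D1 hr'2) hFc).clm_apply continuousAt_const
    refine continuousAt_const.eventually_lt h1 ?_
    rw [← AA_re, hv]; norm_num
  filter_upwards [ev1, ev2, ev3, isOpen_ball.eventually_mem (mem_ball_self hs2 : p ∈ ball p s2)] with z0 hz1 hz2 hz3 hz4 hrz0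
  by_contra hcon
  push Not at hcon
  have hz0c := ball_subset_closedBall hz4
  obtain ⟨hz0U, hz0ε⟩ := hb hz0c
  set w0 := F z0 with hw0
  set δ := -r' w0 with hδ
  have hδp : 0 < δ := by have := H.neg z0 hz0U hrz0; linarith
  set A := AA (fderiv ℝ r' w0) with hA
  have hAv : 1 / 2 ≤ ‖A v‖ := by
    have h1 := abs_re_le_norm (A v)
    rw [hA, AA_re, ← hA] at h1
    have h2 := le_abs_self (fderiv ℝ r' w0 v)
    linarith
  have hAv0 : A v ≠ 0 := by intro h; rw [h] at hAv; norm_num at hAv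
  set n : C2 := (A v)⁻¹ • v with hn
  have hAn : A n = 1 := by rw [hn, map_smul, smul_eq_mul, inv_mul_cancel₀ hAv0]
  have hn0 : n ≠ 0 := by intro h; rw [h] at hAn; simp at hAn
  have hnn : ‖n‖ ≤ 2 * ‖v‖ := by
    rw [hn, norm_smul, norm_inv]
    gcongr
    rw [inv_le_comm₀ (by linarith) (by norm_num)]; linarith
  set G : C2 → ℂ := fun z => (F z - w0).1 * n.2 - (F z - w0).2 * n.1 with hG
  set ζ : C2 → ℂ := fun z => A (F z - w0) with hζ
  have hFw : DifferentiableOn ℂ (fun z => F z - w0) (ball p s) := H.F_hol.sub_const w0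
  have hGd : DifferentiableOn ℂ G (ball p s) := (hFw.fst.mul_const _).sub (hFw.snd.mul_const _)
  have hζd : DifferentiableOn ℂ ζ (ball p s) := A.differentiable.comp_differentiableOn hFw
  have hGF : ∀ z, G z = 0 → F z - w0 = ζ z • n := by
    intro z hz
    obtain ⟨c, hc⟩ := det_zero hn0 hz
    simp only [hζ]
    rw [hc, map_smul, hAn]; simp
  set X : Set C2 := {z | z ∈ closedBall p s2 ∧ r z ≤ 0 ∧ G z = 0 ∧ ‖ζ z‖ ≤ 3 * δ} with hX
  have hXr : ∀ z ∈ X, r z < 0 ∧ (ζ z).re ≤ 3 / 2 * δ := by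
    rintro z ⟨h1, h2, h3, h4⟩
    have h5 := hGF z h3
    have h6 : ‖F z - w0‖ ≤ 6 * ‖v‖ * δ := by
      rw [h5, norm_smul]
      calc _ ≤ (3 * δ) * (2 * ‖v‖) := by gcongr
        _ = _ := by ring
    have h7 : r z ≠ 0 := fun h => by
      have := hcon z (hsub h1) h
      linarith
    have h8 : r z < 0 := lt_of_le_of_ne h2 h7
    refine ⟨h8, ?_⟩
    have h9 := H.neg z (hsub h1) h8
    have h10 := hTlow w0 hz0ε (F z) (hb h1).2
    have h11 : fderiv ℝ r' w0 (F z - w0) = (ζ z).re := by simp only [hζ, hA, AA_re]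
    have h12 : ‖F z - w0‖ ^ 2 ≤ (6 * ‖v‖ * δ) ^ 2 := by gcongr
    have h13 : C2' * ‖F z - w0‖ ^ 2 ≤ C2' * (6 * ‖v‖ * δ) ^ 2 := by gcongr
    have h14 : C2' * (6 * ‖v‖ * δ) ^ 2 = (C2' * (36 * ‖v‖ ^ 2) * δ) * δ := by ring
    have h15 : (C2' * (36 * ‖v‖ ^ 2) * δ) * δ ≤ 1 / 2 * δ := by gcongr
    rw [h11] at h10
    linarith
  have hζne : ∀ z ∈ X, ((2 * δ : ℝ) : ℂ) - ζ z ≠ 0 := by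
    intro z hz h0
    have h1 := congrArg Complex.re h0
    have h2 := (hXr z hz).2
    simp at h1; linarith
  have hrc' := hrc.mono hsub
  have hXcl : IsClosed X := by
    have h3 : IsClosed (closedBall p s2 ∩ r ⁻¹' Iic 0) :=
      hrc'.preimage_isClosed_of_isClosed isClosed_closedBall isClosed_Iic
    have h4 : IsClosed (closedBall p s2 ∩ G ⁻¹' {0}) :=
      (hGd.continuousOn.mono hsub).preimage_isClosed_of_isClosed isClosed_closedBall isClosed_singleton
    have h5 : IsClosed (closedBall p s2 ∩ (fun z => ‖ζ z‖) ⁻¹' Iic (3 * δ)) :=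
      (hζd.continuousOn.mono hsub).norm.preimage_isClosed_of_isClosed isClosed_closedBall isClosed_Iic
    convert (h3.inter h4).inter h5 using 1
    ext z; simp [hX]; tauto
  have hXc : IsCompact X := (isCompact_closedBall p s2).of_isClosed_subset hXcl (fun z hz => hz.1)
  set V : Set C2 := ((ball p s2 ∩ r ⁻¹' Iio 0) ∩ (ball p s2 ∩ (fun z => ‖ζ z‖) ⁻¹' Iio (3 * δ))) ∩
    (ball p s2 ∩ ζ ⁻¹' {((2 * δ : ℝ) : ℂ)}ᶜ) with hV
  have hsub' : ball p s2 ⊆ ball p s := ball_subset_closedBall.trans hsub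
  have hVo : IsOpen V := by
    refine IsOpen.inter (IsOpen.inter ?_ ?_) ?_
    · exact (hrc.mono hsub').isOpen_inter_preimage isOpen_ball isOpen_Iio
    · exact (hζd.continuousOn.mono hsub').norm.isOpen_inter_preimage isOpen_ball isOpen_Iio
    · exact (hζd.continuousOn.mono hsub').isOpen_inter_preimage isOpen_ball isOpen_compl_singleton
  have hVU : V ⊆ ball p s := fun z hz => hsub' hz.2.1
  have hg2 : ∀ z ∈ ball p s, ((2 * δ : ℝ) : ℂ) - ζ z ≠ 0 → ContDiffAt ℂ 2 (fun z => (K : ℂ) * (ζ z / (((2 * δ : ℝ) : ℂ) - ζ z))) z := by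
    intro z hz hne
    have h1 : ContDiffAt ℂ 2 ζ z := (hol_contDiffOn 2 isOpen_ball hζd).contDiffAt (isOpen_ball.mem_nhds hz)
    exact contDiffAt_const.mul (h1.div (contDiffAt_const.sub h1) hne)
  set Φ : C2 → ℝ := fun z => (r z + (-μ) * esq (z - p)) + ((K : ℂ) * (ζ z / (((2 * δ : ℝ) : ℂ) - ζ z))).re with hΦ
  have hre2 : ∀ z ∈ ball p s, ((2 * δ : ℝ) : ℂ) - ζ z ≠ 0 → ContDiffAt ℝ 2 (fun z => ((K : ℂ) * (ζ z / (((2 * δ : ℝ) : ℂ) - ζ z))).re) z := by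
    intro z hz hne
    exact reCLM.contDiff.contDiffAt.comp z ((hg2 z hz hne).restrict_scalars ℝ)
  have hΦ2 : ∀ z ∈ ball p s, ((2 * δ : ℝ) : ℂ) - ζ z ≠ 0 → ContDiffAt ℝ 2 Φ z := by
    intro z hz hne
    exact (hΦ02 z hz).add (hre2 z hz hne)
  have hVne : ∀ z ∈ V, ((2 * δ : ℝ) : ℂ) - ζ z ≠ 0 := by
    intro z hz h0
    exact hz.2.2 (sub_eq_zero.1 h0).symm
  have hfin := maxp hGd hXc (fun z hz => hsub hz.1) (fun z hz => hz.2.2.1) hVo hVU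
    (fun z hz hGz => ⟨ball_subset_closedBall hz.2.1, le_of_lt hz.1.1.2, hGz, le_of_lt hz.1.2.2⟩) (Φ := Φ)
    (fun z hz => (hΦ2 z (hsub hz.1) (hζne z hz)).continuousAt.continuousWithinAt)
    (fun z hz => hΦ2 z (hVU hz) (hVne z hz))
    (fun z hz t ht => by
      have hzU := hVU hz
      have e1 := LL_add (hΦ02 z hzU) (hre2 z hzU (hVne z hz)) t
      have e2 : LL Φ z t = _ := e1
      rw [e2, (LL_sub_esq (hr2 z hzU) μ p t).2, LL_re_hol (hg2 z hzU (hVne z hz))]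
      have h3 := H.r_LL z hzU t
      have h4 := esq_le t
      have h5 := norm_pos_iff.2 ht
      have h6 : 4 * μ * esq t ≤ 4 * μ * (2 * ‖t‖ ^ 2) := by gcongr
      have h7 : 0 < m * ‖t‖ ^ 2 := by have := H.m_pos; positivity
      rw [hμ] at h6 ⊢
      linarith) (m := -(K / 5))
    (fun z hz hzV => by
      obtain ⟨h1, h2⟩ := hXr z hz
      have hcases : z ∉ ball p s2 ∨ ‖ζ z‖ = 3 * δ := by
        by_contra hh
        push Not at hh
        apply hzV
        refine ⟨⟨⟨hh.1, h1⟩, ⟨hh.1, lt_of_le_of_ne hz.2.2.2 hh.2⟩⟩, ⟨hh.1, ?_⟩⟩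
        intro h0
        exact hζne z hz (sub_eq_zero.2 (Eq.symm h0))
      have hKre : ((K : ℂ) * (ζ z / (((2 * δ : ℝ) : ℂ) - ζ z))).re = K * (ζ z / (((2 * δ : ℝ) : ℂ) - ζ z)).re := by
        rw [re_ofReal_mul]
      have hes := esq_ge (z - p)
      simp only [hΦ]
      rw [hKre]
      rcases hcases with h | h
      · have h6 : s2 ≤ ‖z - p‖ := by simpa [dist_eq_norm] using h
        have h8 : s2 ^ 2 ≤ ‖z - p‖ ^ 2 := by gcongr
        have h9 := pole_bd1 hδp h2
        have h10 : K * (ζ z / (((2 * δ : ℝ) : ℂ) - ζ z)).re ≤ K * 3 := by gcongr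
        have h11 : μ * s2 ^ 2 ≤ μ * esq (z - p) := by gcongr; linarith
        have h12 : μ * s2 ^ 2 = 6 * K := by rw [hK]; ring
        linarith
      · have h9 := pole_bd2 hδp h2 h
        have h10 : K * (ζ z / (((2 * δ : ℝ) : ℂ) - ζ z)).re ≤ K * (-(1 / 5)) := by gcongr
        have h11 : 0 ≤ μ * esq (z - p) := mul_nonneg hμp.le ((by positivity : (0:ℝ) ≤ ‖z - p‖ ^ 2).trans hes)
        linarith)
  have h9 := hfin z0 ⟨hz0c, hrz0.le, by simp [hG, ← hw0], by simp [hζ, ← hw0]; linarith⟩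
  have h10 : ζ z0 = 0 := by simp [hζ, ← hw0]
  simp only [hΦ, h10] at h9
  simp at h9
  linarith

lemma lip_loc {E G : Type*} [NormedAddCommGroup E] [NormedSpace ℝ E] [NormedAddCommGroup G] [NormedSpace ℝ G]
    {g : E → G} {x : E} (h : ContDiffAt ℝ 1 g x) :
    ∃ K > 0, ∃ ε > 0, ∀ a ∈ ball x ε, ∀ b ∈ ball x ε, ‖g a - g b‖ ≤ K * ‖a - b‖ := by
  obtain ⟨K, t, ht, hL⟩ := h.exists_lipschitzOnWith
  obtain ⟨ε, hε, hb⟩ := Metric.mem_nhds_iff.1 ht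
  refine ⟨K + 1, by positivity, ε, hε, fun a ha b hb' => ?_⟩
  have := hL.norm_sub_le (hb ha) (hb hb')
  have h0 := norm_nonneg (a - b)
  nlinarith

set_option maxHeartbeats 1000000 in
lemma levi_compare {R : C2 → ℝ} {w0 : C2} (h : ContDiffAt ℝ 3 R w0) (hD : fderiv ℝ R w0 ≠ 0) :
    ∃ ε > 0, ∃ C > 0, ∀ w ∈ ball w0 ε, ∀ x ∈ ball w0 ε,
      (∀ t, fderiv ℝ R x t = 0 → fderiv ℝ R x (I • t) = 0 → 0 ≤ LL R x t) →
      ∀ τ, -(C * ‖τ‖ * (‖w - x‖ * ‖τ‖ + |fderiv ℝ R w τ| + |fderiv ℝ R w (I • τ)|)) ≤ LL R w τ := by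
  have h1 : ContDiffAt ℝ 2 (fderiv ℝ R) w0 := h.fderiv_right (by norm_num)
  have h2 : ContDiffAt ℝ 1 (fderiv ℝ (fderiv ℝ R)) w0 := h1.fderiv_right (by norm_num)
  obtain ⟨K1, hK1, ε1, hε1, hl1⟩ := lip_loc (h1.of_le (by norm_num) : ContDiffAt ℝ 1 (fderiv ℝ R) w0)
  obtain ⟨K2, hK2, ε2, hε2, hl2⟩ := lip_loc h2
  obtain ⟨v, hv⟩ := exists_one (AA_ne hD)
  have ev3 : ∀ᶠ x in nhds w0, 1 / 2 < fderiv ℝ R x v := by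
    refine continuousAt_const.eventually_lt (h1.continuousAt.clm_apply continuousAt_const) ?_
    rw [← AA_re, hv]; norm_num
  have ev4 : ∀ᶠ x in nhds w0, ‖fderiv ℝ R x‖ < ‖fderiv ℝ R w0‖ + 1 :=
    h1.continuousAt.norm.eventually_lt continuousAt_const (by linarith)
  have ev5 : ∀ᶠ x in nhds w0, ‖fderiv ℝ (fderiv ℝ R) x‖ < ‖fderiv ℝ (fderiv ℝ R) w0‖ + 1 :=
    h2.continuousAt.norm.eventually_lt continuousAt_const (by linarith)
  obtain ⟨ε3, hε3, hb3⟩ := Metric.nhds_basis_ball.eventually_iff.1 (ev3.and (ev4.and ev5))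
  set B1 := ‖fderiv ℝ R w0‖ + 1
  set B2 := ‖fderiv ℝ (fderiv ℝ R) w0‖ + 1
  have hB1 : 0 < B1 := by positivity
  have hB2 : 0 < B2 := by positivity
  set G := 2 * B2 * (2 * ‖v‖) * (2 + 4 * ‖v‖ * B1) with hG
  have hG0 : 0 ≤ G := by positivity
  refine ⟨min ε1 (min ε2 ε3), by positivity, 2 * K2 + G * (1 + 2 * K1), by positivity, ?_⟩
  intro w hw x hx hpsc τ
  simp only [mem_ball, lt_min_iff] at hw hx
  have hl1' := hl1 w hw.1 x hx.1
  have hl2' := hl2 w hw.2.1 x hx.2.1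
  obtain ⟨hx3, hx4, hx5⟩ := hb3 hx.2.2
  set A := AA (fderiv ℝ R x) with hA
  have hAv : 1 / 2 ≤ ‖A v‖ := by
    have h1 := abs_re_le_norm (A v)
    rw [hA, AA_re, ← hA] at h1
    have h2 := le_abs_self (fderiv ℝ R x v)
    linarith
  have hAv0 : A v ≠ 0 := by intro h; rw [h] at hAv; norm_num at hAv
  set d : C2 := (A τ / A v) • v with hd
  set τ' := τ - d with hτ'
  have hAt : A τ' = 0 := by simp [hτ', hd, hAv0]
  have hpos := hpsc τ' ((AA_eq_zero_iff _ _).1 hAt).1 ((AA_eq_zero_iff _ _).1 hAt).2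
  have hdn : ‖d‖ ≤ 2 * ‖v‖ * ‖A τ‖ := by
    rw [hd, norm_smul, norm_div]
    have : ‖A τ‖ / ‖A v‖ ≤ 2 * ‖A τ‖ := by
      rw [div_le_iff₀ (by linarith)]
      nlinarith [norm_nonneg (A τ)]
    nlinarith [norm_nonneg v]
  have hAτ : ‖A τ‖ ≤ |fderiv ℝ R x τ| + |fderiv ℝ R x (I • τ)| := by
    have := Complex.norm_le_abs_re_add_abs_im (A τ)
    rwa [hA, AA_re, AA_im, abs_neg] at this
  have hDx : ∀ y : C2, |fderiv ℝ R x y| ≤ B1 * ‖y‖ := fun y => by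
    have := (fderiv ℝ R x).le_opNorm y
    rw [Real.norm_eq_abs] at this
    nlinarith [norm_nonneg y]
  have hDwx : ∀ y : C2, |fderiv ℝ R x y| ≤ |fderiv ℝ R w y| + K1 * ‖w - x‖ * ‖y‖ := fun y => by
    have h3 := (fderiv ℝ R w - fderiv ℝ R x).le_opNorm y
    rw [Real.norm_eq_abs, sub_apply] at h3
    have h4 := abs_sub_abs_le_abs_sub (fderiv ℝ R x y) (fderiv ℝ R w y)
    rw [abs_sub_comm] at h4
    have : ‖fderiv ℝ R w - fderiv ℝ R x‖ * ‖y‖ ≤ K1 * ‖w - x‖ * ‖y‖ := by gcongr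
    linarith
  have e1 := hDx τ
  have e2 := hDx (I • τ)
  have e3 := hDwx τ
  have e4 := hDwx (I • τ)
  rw [norm_I_smul] at e2 e4
  have hd2 : ‖d‖ ≤ 4 * ‖v‖ * B1 * ‖τ‖ := by nlinarith [norm_nonneg v]
  have hτn : ‖τ'‖ ≤ ‖τ‖ + ‖d‖ := norm_sub_le _ _
  have hLL : LL R x τ' - 2 * B2 * ‖d‖ * (‖τ'‖ + ‖τ‖) ≤ LL R x τ := by
    have hB : ∀ a b : C2, |fderiv ℝ (fderiv ℝ R) x a b| ≤ B2 * ‖a‖ * ‖b‖ := fun a b => by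
      have := (fderiv ℝ (fderiv ℝ R) x).le_opNorm₂ a b
      rw [Real.norm_eq_abs] at this
      refine this.trans ?_
      gcongr
    have hτe : τ = τ' + d := by simp [hτ']
    have s1 := (abs_le.1 (hB d τ')).1
    have s2 := (abs_le.1 (hB τ d)).1
    have s3 := (abs_le.1 (hB (I • d) (I • τ'))).1
    have s4 := (abs_le.1 (hB (I • τ) (I • d))).1
    rw [norm_I_smul, norm_I_smul] at s3 s4
    have k1 : fderiv ℝ (fderiv ℝ R) x τ τ = fderiv ℝ (fderiv ℝ R) x τ' τ' + fderiv ℝ (fderiv ℝ R) x d τ' + fderiv ℝ (fderiv ℝ R) x τ d := by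
      simp [hτ']
    have k2 : fderiv ℝ (fderiv ℝ R) x (I • τ) (I • τ) = fderiv ℝ (fderiv ℝ R) x (I • τ') (I • τ') + fderiv ℝ (fderiv ℝ R) x (I • d) (I • τ') + fderiv ℝ (fderiv ℝ R) x (I • τ) (I • d) := by
      simp [hτ', smul_sub]
    have k3 : LL R x τ = fderiv ℝ (fderiv ℝ R) x τ τ + fderiv ℝ (fderiv ℝ R) x (I • τ) (I • τ) := rfl
    have k4 : LL R x τ' = fderiv ℝ (fderiv ℝ R) x τ' τ' + fderiv ℝ (fderiv ℝ R) x (I • τ') (I • τ') := rfl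
    have k5 : 2 * B2 * ‖d‖ * (‖τ'‖ + ‖τ‖) = 2 * (B2 * ‖d‖ * ‖τ'‖) + 2 * (B2 * ‖τ‖ * ‖d‖) := by ring
    linarith
  have hdiff := (abs_le.1 (LL_diff_le R R w x τ)).1
  have hn0 := norm_nonneg τ
  have t1 : 2 * B2 * ‖d‖ * (‖τ'‖ + ‖τ‖) ≤ G * ‖A τ‖ * ‖τ‖ := by
    have : ‖τ'‖ + ‖τ‖ ≤ (2 + 4 * ‖v‖ * B1) * ‖τ‖ := by nlinarith
    calc 2 * B2 * ‖d‖ * (‖τ'‖ + ‖τ‖) ≤ 2 * B2 * (2 * ‖v‖ * ‖A τ‖) * ((2 + 4 * ‖v‖ * B1) * ‖τ‖) := by gcongr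
      _ = _ := by rw [hG]; ring
  set X := ‖w - x‖ * ‖τ‖ with hX
  set Y := |fderiv ℝ R w τ| + |fderiv ℝ R w (I • τ)| with hY
  have hX0 : 0 ≤ X := by positivity
  have hY0 : 0 ≤ Y := by positivity
  have t2 : ‖A τ‖ ≤ Y + 2 * K1 * X := by rw [hX, hY]; nlinarith
  have t3 : 2 * ‖fderiv ℝ (fderiv ℝ R) w - fderiv ℝ (fderiv ℝ R) x‖ * ‖τ‖ ^ 2 ≤ 2 * K2 * X * ‖τ‖ := by
    calc _ ≤ 2 * (K2 * ‖w - x‖) * ‖τ‖ ^ 2 := by gcongr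
      _ = _ := by rw [hX]; ring
  have t4 : G * ‖A τ‖ * ‖τ‖ ≤ G * (Y + 2 * K1 * X) * ‖τ‖ := by gcongr
  have t5 : G * (Y + 2 * K1 * X) * ‖τ‖ + 2 * K2 * X * ‖τ‖ ≤ (2 * K2 + G * (1 + 2 * K1)) * ‖τ‖ * (X + Y) := by
    have : 0 ≤ G * X * ‖τ‖ + G * 2 * K1 * Y * ‖τ‖ + 2 * K2 * Y * ‖τ‖ := by positivity
    nlinarith
  have : ‖w - x‖ * ‖τ‖ + |fderiv ℝ R w τ| + |fderiv ℝ R w (I • τ)| = X + Y := by rw [hX, hY]; ring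
  rw [this]
  linarith

lemma fderiv_comp_hol {F : C2 → C2} {R : C2 → ℝ} {z : C2} (hF : DifferentiableAt ℂ F z) (hR : DifferentiableAt ℝ R (F z)) (t : C2) :
    fderiv ℝ (R ∘ F) z t = fderiv ℝ R (F z) (fderiv ℂ F z t) := by
  rw [fderiv_comp z hR (hF.restrictScalars ℝ), hF.fderiv_restrictScalars ℝ]
  rfl

lemma Loc.FC {r r' : C2 → ℝ} {F : C2 → C2} {p : C2} {s m : ℝ} (H : Loc r r' F p s m) {z : C2} (hz : z ∈ ball p s) :
    ContDiffAt ℂ 2 F z := ((hol_contDiffOn2 2 isOpen_ball H.F_hol) z hz).contDiffAt (isOpen_ball.mem_nhds hz)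

lemma Loc.uC {r r' : C2 → ℝ} {F : C2 → C2} {p : C2} {s m : ℝ} (H : Loc r r' F p s m) {z : C2} (hz : z ∈ ball p s) :
    ContDiffAt ℝ 2 (r' ∘ F) z :=
  ContDiffAt.comp z ((H.r'_cd z hz).of_le (by norm_num)) ((H.FC hz).restrict_scalars ℝ)

lemma Loc.levi {r r' : C2 → ℝ} {F : C2 → C2} {p : C2} {s m : ℝ} (H : Loc r r' F p s m) (ν : C2) :
    ∃ C > 0, ∀ᶠ z in nhds p, r z < 0 →
      -(C * (-(r' ∘ F) z + |fderiv ℝ (r' ∘ F) z ν| + |fderiv ℝ (r' ∘ F) z (I • ν)|)) ≤ LL (r' ∘ F) z ν := by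
  have hpU : p ∈ ball p s := mem_ball_self H.s_pos
  obtain ⟨ε, hε, C, hC, hcmp⟩ := levi_compare (H.r'_cd p hpU) (H.r'_D p hpU)
  obtain ⟨C1, hC1, hnear⟩ := H.near
  have hFc : ContinuousAt F p := (H.FC hpU).continuousAt
  have huc : ContinuousAt (fun z => C1 * (-r' (F z))) p := continuousAt_const.mul (H.uC hpU).continuousAt.neg
  have hu0 : r' (F p) = 0 := H.zero p hpU H.rp
  have hT : ContinuousAt (fun z => ‖fderiv ℂ F z ν‖) p :=
    (((H.FC hpU).fderiv_right (m := 1) (by norm_num)).continuousAt.clm_apply continuousAt_const).norm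
  set T := ‖fderiv ℂ F p ν‖ + 1 with hTd
  have hTp : 0 < T := by positivity
  refine ⟨C * T * (C1 * T + 1), by positivity, ?_⟩
  filter_upwards [hnear, isOpen_ball.eventually_mem hpU,
    hFc.eventually (isOpen_ball.eventually_mem (mem_ball_self (half_pos hε))),
    huc.eventually_lt continuousAt_const (show C1 * (-r' (F p)) < ε / 2 by rw [hu0]; simp; exact hε),
    hT.eventually_lt continuousAt_const (show ‖fderiv ℂ F p ν‖ < T by linarith)] with z h1 hz h2 h3 h4 hrz
  obtain ⟨q, hq, hrq, hqn⟩ := h1 hrz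
  have hFd : DifferentiableAt ℂ F z := (H.FC hz).differentiableAt (by norm_num)
  have hRd : DifferentiableAt ℝ r' (F z) := (H.r'_cd z hz).differentiableAt (by norm_num)
  rw [fderiv_comp_hol hFd hRd, fderiv_comp_hol hFd hRd, LL_comp (H.FC hz) ((H.r'_cd z hz).of_le (by norm_num)),
    ContinuousLinearMap.map_smul]
  set τ := fderiv ℂ F z ν
  have hFq : F q ∈ ball (F p) ε := by
    rw [mem_ball] at h2 ⊢
    have := dist_triangle (F q) (F z) (F p)
    rw [dist_eq_norm (F q) (F z)] at this
    linarith
  have key := hcmp (F z) (ball_subset_ball (by linarith) h2) (F q) hFq (fun t a b => H.A hq hrq a b) τ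
  rw [norm_sub_rev] at hqn
  set a := |fderiv ℝ r' (F z) τ|
  set b := |fderiv ℝ r' (F z) (I • τ)|
  have ha : 0 ≤ a := abs_nonneg _
  have hb : 0 ≤ b := abs_nonneg _
  have hδ : 0 < -r' (F z) := by have := H.neg z hz hrz; linarith
  have : C * ‖τ‖ * (‖F z - F q‖ * ‖τ‖ + a + b) ≤ C * T * (C1 * (-r' (F z)) * T + a + b) := by gcongr
  have h6 : C * T * (C1 * (-r' (F z)) * T + a + b) ≤ C * T * (C1 * T + 1) * (-r' (F z) + a + b) := by
    have : 0 ≤ C * T * (C1 * T * a + C1 * T * b + (-r' (F z))) := by positivity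
    nlinarith
  simp only [Function.comp]
  linarith

lemma pos_right {φ : ℝ → ℝ} {d : ℝ} (h : HasDerivAt φ d 0) (h0 : φ 0 = 0) (hd : 0 < d) :
    ∀ᶠ x in nhdsWithin 0 (Ioi 0), 0 < φ x := by
  have h1 := (hasDerivAt_iff_tendsto_slope.1 h).mono_left (nhdsWithin_mono 0 (fun x (hx : 0 < x) => (ne_of_gt hx : x ≠ 0)))
  filter_upwards [h1.eventually (lt_mem_nhds hd), self_mem_nhdsWithin] with x hx hx0
  rw [slope_def_field, h0] at hx
  simp only [sub_zero] at hx
  exact (div_pos_iff_of_pos_right hx0).1 hx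

lemma deriv_line {g : C2 → ℝ} {p : C2} (hg : DifferentiableAt ℝ g p) (v : C2) :
    HasDerivAt (fun x : ℝ => g (p + x • v)) (fderiv ℝ g p v) 0 := by
  have h1 : HasDerivAt (fun x : ℝ => p + x • v) v 0 := by
    simpa using ((hasDerivAt_id (0:ℝ)).smul_const v).const_add p
  have h2 : HasFDerivAt g (fderiv ℝ g p) (p + (0:ℝ) • v) := by simpa using hg.hasFDerivAt
  exact h2.comp_hasDerivAt 0 h1

lemma exp_comp {ρ : C2 → ℝ} {z : C2} (h : ContDiffAt ℝ 2 ρ z) (N : ℝ) (t : C2) :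
    ContDiffAt ℝ 2 (fun z => Real.exp (-N * ρ z) - 1) z ∧
    fderiv ℝ (fun z => Real.exp (-N * ρ z) - 1) z = (-N * Real.exp (-N * ρ z)) • fderiv ℝ ρ z ∧
    LL (fun z => Real.exp (-N * ρ z) - 1) z t = Real.exp (-N * ρ z) *
      (-N * LL ρ z t + N ^ 2 * (fderiv ℝ ρ z t ^ 2 + fderiv ℝ ρ z (I • t) ^ 2)) := by
  have h1 : ∀ x : ℝ, HasDerivAt (fun x => Real.exp (-N * x) - 1) (-N * Real.exp (-N * x)) x := by
    intro x
    have := ((((hasDerivAt_id x).const_mul (-N)).exp).sub_const 1)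
    refine this.congr_deriv ?_
    ring_nf; try simp
  have h2 : ∀ x : ℝ, HasDerivAt (fun x => -N * Real.exp (-N * x)) (N ^ 2 * Real.exp (-N * x)) x := by
    intro x
    have := ((((hasDerivAt_id x).const_mul (-N)).exp).const_mul (-N))
    refine this.congr_deriv ?_
    ring_nf; try simp
  refine ⟨?_, ?_, ?_⟩
  · exact ((contDiffAt_const.mul h).exp).sub contDiffAt_const
  · exact D1_scomp (h.differentiableAt (by norm_num)) h1
  · rw [LL_scomp h h1 h2]; ring

set_option maxHeartbeats 1000000 in
lemma hopf {r u : C2 → ℝ} {p ν : C2} {s : ℝ} (hs : 0 < s)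
    (hr : ∀ z ∈ ball p s, ContDiffAt ℝ 2 r z) (hu : ∀ z ∈ ball p s, ContDiffAt ℝ 2 u z)
    (hrp : r p = 0) (hν : fderiv ℝ r p ν = 1)
    (hneg : ∀ z ∈ ball p s, r z < 0 → u z < 0) (hzero : ∀ z ∈ ball p s, r z = 0 → u z = 0)
    {C : ℝ} (hC : 0 < C) (hlev : ∀ᶠ z in nhds p, r z < 0 →
      -(C * (-u z + |fderiv ℝ u z ν| + |fderiv ℝ u z (I • ν)|)) ≤ LL u z ν) :
    0 < fderiv ℝ u p ν := by
  have hpU : p ∈ ball p s := mem_ball_self hs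
  set ρ : C2 → ℝ := fun z => r z + esq (z - p) with hρ
  have hesq : ContDiff ℝ 2 (fun z => esq (z - p)) := esq_contDiff p
  have hρC : ∀ z ∈ ball p s, ContDiffAt ℝ 2 ρ z := fun z hz => (hr z hz).add hesq.contDiffAt
  have hesq0 : esq (p - p) = 0 := by simp [esq]
  have hρp : ρ p = 0 := by simp only [hρ]; rw [hrp, hesq0]; simp
  have hDρ : fderiv ℝ ρ p = fderiv ℝ r p := by
    have := fderiv_add ((hr p hpU).differentiableAt (by norm_num)) (hesq.contDiffAt.differentiableAt (x := p) (by norm_num))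
    rw [fderiv_esq_self, add_zero] at this
    exact this
  set B := ‖fderiv ℝ ρ p‖ * ‖ν‖ + 1 with hB
  have hB1 : 1 ≤ B := by rw [hB]; have : 0 ≤ ‖fderiv ℝ ρ p‖ * ‖ν‖ := by positivity
                         linarith
  set L := |LL ρ p ν| + 1 with hL
  have hL0 : 0 < L := by positivity
  have hcD : ContinuousAt (fderiv ℝ ρ) p := contAt_D1 (hρC p hpU)
  have ev1 : ∀ᶠ z in nhds p, 1 / 2 < fderiv ℝ ρ z ν :=
    continuousAt_const.eventually_lt (hcD.clm_apply continuousAt_const) (by rw [hDρ, hν]; norm_num)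
  have ev2 : ∀ᶠ z in nhds p, ‖fderiv ℝ ρ z‖ * ‖ν‖ < B :=
    (hcD.norm.mul continuousAt_const).eventually_lt continuousAt_const (by change ‖fderiv ℝ ρ p‖ * ‖ν‖ < B; rw [hB]; linarith)
  have ev3 : ∀ᶠ z in nhds p, LL ρ z ν < L := by
    have hc2 : ContinuousAt (fderiv ℝ (fderiv ℝ ρ)) p := contAt_D2 (hρC p hpU)
    have : ContinuousAt (fun z => LL ρ z ν) p :=
      ((hc2.clm_apply continuousAt_const).clm_apply continuousAt_const).add ((hc2.clm_apply continuousAt_const).clm_apply continuousAt_const)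
    refine this.eventually_lt continuousAt_const ?_
    rw [hL]; have := le_abs_self (LL ρ p ν); linarith
  obtain ⟨s2, hs2, hb⟩ := Metric.nhds_basis_closedBall.eventually_iff.1
    (hlev.and (ev1.and (ev2.and (ev3.and (isOpen_ball.eventually_mem hpU)))))
  set N := 4 * (L + C * (1 + 2 * B)) + 1 with hN
  have hN1 : 1 < N := by have : 0 < L + C * (1 + 2 * B) := by positivity
                         rw [hN]; linarith
  set b : C2 → ℝ := fun z => Real.exp (-N * ρ z) - 1 with hbd
  have hsub : closedBall p s2 ⊆ ball p s := fun z hz => (hb hz).2.2.2.2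
  have hbC : ∀ z ∈ ball p s, ContDiffAt ℝ 2 b z := fun z hz => (exp_comp (hρC z hz) N 0).1
  have hDb : ∀ z ∈ ball p s, fderiv ℝ b z = (-N * Real.exp (-N * ρ z)) • fderiv ℝ ρ z := fun z hz => (exp_comp (hρC z hz) N 0).2.1
  have hbstrict : ∀ z ∈ closedBall p s2, C * (b z + |fderiv ℝ b z ν| + |fderiv ℝ b z (I • ν)|) < LL b z ν := by
    intro z hz
    obtain ⟨-, h1, h2, h3, hzU⟩ := hb hz
    rw [hDb z hzU, (exp_comp (hρC z hzU) N ν).2.2]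
    have hE : 0 < Real.exp (-N * ρ z) := Real.exp_pos _
    set E := Real.exp (-N * ρ z) with hEd
    have hbz : b z = E - 1 := rfl
    have hab : ∀ x : ℝ, |(-N * E) * x| = N * E * |x| := fun x => by
      rw [abs_mul, neg_mul, abs_neg, abs_of_pos (by positivity)]
    have hx1 : |fderiv ℝ ρ z ν| ≤ B := by
      have := (fderiv ℝ ρ z).le_opNorm ν
      rw [Real.norm_eq_abs] at this; linarith
    have hx2 : |fderiv ℝ ρ z (I • ν)| ≤ B := by
      have := (fderiv ℝ ρ z).le_opNorm (I • ν)
      rw [Real.norm_eq_abs, norm_I_smul] at this; linarith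
    simp only [smul_apply, smul_eq_mul, hab, hbz]
    have hN2 : N * (L + C * (1 + 2 * B)) < N ^ 2 / 4 := by
      have : L + C * (1 + 2 * B) < N / 4 := by rw [hN]; linarith
      nlinarith
    have k1 : C * (E - 1 + N * E * |fderiv ℝ ρ z ν| + N * E * |fderiv ℝ ρ z (I • ν)|) ≤ C * (N * E + N * E * B + N * E * B) := by
      have : E - 1 ≤ N * E := by nlinarith
      gcongr
    have k2 : E * (N ^ 2 / 4 - N * L) ≤ E * (-N * LL ρ z ν + N ^ 2 * (fderiv ℝ ρ z ν ^ 2 + fderiv ℝ ρ z (I • ν) ^ 2)) := by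
      gcongr
      have k3 : 1 / 4 ≤ fderiv ℝ ρ z ν ^ 2 + fderiv ℝ ρ z (I • ν) ^ 2 := by nlinarith
      have k4 : N ^ 2 * (1 / 4) ≤ N ^ 2 * (fderiv ℝ ρ z ν ^ 2 + fderiv ℝ ρ z (I • ν) ^ 2) := by gcongr
      have k5 : N * LL ρ z ν ≤ N * L := by gcongr
      linarith
    have k6 : C * (N * E + N * E * B + N * E * B) < E * (N ^ 2 / 4 - N * L) := by
      have : 0 < E * (N ^ 2 / 4 - N * (L + C * (1 + 2 * B))) := mul_pos hE (by linarith)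
      nlinarith
    linarith
  have hcρ : ContinuousOn ρ (closedBall p s2) := fun z hz => (hρC z (hsub hz)).continuousAt.continuousWithinAt
  have hcu : ContinuousOn u (closedBall p s2) := fun z hz => (hu z (hsub hz)).continuousAt.continuousWithinAt
  have hcb : ContinuousOn b (closedBall p s2) := fun z hz => (hbC z (hsub hz)).continuousAt.continuousWithinAt
  set K := closedBall p s2 ∩ ρ ⁻¹' (Iic 0) with hK
  have hKc : IsCompact K :=
    (isCompact_closedBall p s2).of_isClosed_subset (hcρ.preimage_isClosed_of_isClosed isClosed_closedBall isClosed_Iic) inter_subset_left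
  have hKs : K ⊆ closedBall p s2 := inter_subset_left
  have hpK : p ∈ K := ⟨mem_closedBall_self hs2.le, by simp [hρp]⟩
  have hrρ : ∀ z, r z = ρ z - esq (z - p) := fun z => by simp only [hρ]; ring
  have hule : ∀ z ∈ K, u z ≤ 0 := by
    intro z hz
    have h1 : r z ≤ 0 := by
      rw [hrρ z]; have := (sq_nonneg ‖z - p‖).trans (esq_ge (z - p)); have h3 : ρ z ≤ 0 := hz.2; linarith
    rcases h1.lt_or_eq with h | h
    · exact (hneg z (hsub hz.1) h).le
    · exact (hzero z (hsub hz.1) h).le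
  -- bound on the sphere part
  obtain ⟨c, hc, hcS⟩ : ∃ c > 0, ∀ z ∈ K ∩ sphere p s2, u z ≤ -c := by
    have hSc : IsCompact (K ∩ sphere p s2) := hKc.inter_right isClosed_sphere
    rcases (K ∩ sphere p s2).eq_empty_or_nonempty with he | hne
    · exact ⟨1, one_pos, fun z hz => by rw [he] at hz; exact hz.elim⟩
    · obtain ⟨z1, hz1, hmx⟩ := hSc.exists_isMaxOn hne (hcu.mono (fun z hz => hKs hz.1))
      refine ⟨-u z1, ?_, fun z hz => by simpa using hmx hz⟩
      have h1 : r z1 < 0 := by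
        rw [hrρ z1]; have h2 := esq_ge (z1 - p); have h3 : ρ z1 ≤ 0 := hz1.1.2
        have h4 : ‖z1 - p‖ = s2 := by rw [← dist_eq_norm]; exact hz1.2
        rw [h4] at h2; have : 0 < s2 ^ 2 := by positivity
        linarith
      have := hneg z1 (hsub hz1.1.1) h1
      linarith
  obtain ⟨z2, hz2, hmxb⟩ := hKc.exists_isMaxOn ⟨p, hpK⟩ (hcb.mono hKs)
  have hbp : b p = 0 := by simp only [hbd, hρp]; simp
  have hb2 : 0 ≤ b z2 := by rw [← hbp]; exact hmxb hpK
  set ε := c / (b z2 + 1) with hε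
  have hεp : 0 < ε := by positivity
  have hεb : ∀ z ∈ K, ε * b z ≤ c := by
    intro z hz
    have h1 : b z ≤ b z2 := hmxb hz
    have h2 : ε * (b z2 + 1) = c := by rw [hε]; field_simp
    nlinarith
  have main : ∀ z ∈ K, u z + ε * b z ≤ 0 := by
    obtain ⟨z0, hz0, hmx⟩ := hKc.exists_isMaxOn ⟨p, hpK⟩ ((hcu.add (continuousOn_const.mul hcb)).mono hKs : ContinuousOn (fun z => u z + ε * b z) K)
    intro z hz
    refine (hmx hz : u z + ε * b z ≤ u z0 + ε * b z0).trans ?_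
    by_contra hpos
    replace hpos : 0 < u z0 + ε * b z0 := not_le.1 hpos
    have hzU := hsub hz0.1
    have h1 : z0 ∉ sphere p s2 := fun h => by
      have := hcS z0 ⟨hz0, h⟩
      have := hεb z0 hz0
      linarith
    have h2 : z0 ∈ ball p s2 := by
      have a1 : dist z0 p ≤ s2 := hz0.1
      have a2 : dist z0 p ≠ s2 := h1
      exact lt_of_le_of_ne a1 a2
    have h3 : ρ z0 < 0 := by
      refine lt_of_le_of_ne hz0.2 fun h => ?_
      have : b z0 = 0 := by simp only [hbd, h]; simp
      rw [this] at hpos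
      have := hule z0 hz0
      linarith
    have hr0 : r z0 < 0 := by
      rw [hrρ z0]; have := (sq_nonneg ‖z0 - p‖).trans (esq_ge (z0 - p)); linarith
    have hloc : IsLocalMax (fun z => u z + ε * b z) z0 := by
      filter_upwards [isOpen_ball.eventually_mem h2, (hρC z0 hzU).continuousAt.eventually_lt continuousAt_const h3] with y hy1 hy2
      exact hmx ⟨ball_subset_closedBall hy1, hy2.le⟩
    have hεbC : ContDiffAt ℝ 2 (fun z => ε * b z) z0 := contDiffAt_const.mul (hbC z0 hzU)
    have hsum : ContDiffAt ℝ 2 (fun z => u z + ε * b z) z0 := (hu z0 hzU).add hεbC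
    obtain ⟨hD0, hD2⟩ := second_test hsum hloc
    have hLL : LL (fun z => u z + ε * b z) z0 ν ≤ 0 := by
      have := hD2 ν; have := hD2 (I • ν); unfold LL; linarith
    rw [LL_add (hu z0 hzU) hεbC, LL_const_mul (hbC z0 hzU)] at hLL
    have hDe : fderiv ℝ u z0 = (-ε) • fderiv ℝ b z0 := by
      have e1 := fderiv_add ((hu z0 hzU).differentiableAt (by norm_num)) (hεbC.differentiableAt (by norm_num))
      have e2 : fderiv ℝ (fun z => ε * b z) z0 = ε • fderiv ℝ b z0 := fderiv_const_mul ((hbC z0 hzU).differentiableAt (by norm_num)) ε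
      have e3 : fderiv ℝ u z0 + ε • fderiv ℝ b z0 = 0 := by rw [← e2, ← e1]; exact hD0
      rw [neg_smul]; exact eq_neg_of_add_eq_zero_left e3
    have hl := (hb hz0.1).1 hr0
    rw [hDe] at hl
    simp only [smul_apply, smul_eq_mul, abs_mul, abs_neg, abs_of_pos hεp] at hl
    have hs3 := hbstrict z0 hz0.1
    have : ε * (C * (b z0 + |fderiv ℝ b z0 ν| + |fderiv ℝ b z0 (I • ν)|)) < ε * LL b z0 ν := by gcongr
    have h5 : C * (-u z0) ≤ C * (ε * b z0) := mul_le_mul_of_nonneg_left (by linarith) hC.le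
    nlinarith
  -- conclude along the inner normal
  have hu' : DifferentiableAt ℝ u p := (hu p hpU).differentiableAt (by norm_num)
  have hb' : DifferentiableAt ℝ b p := (hbC p hpU).differentiableAt (by norm_num)
  have hρ' : DifferentiableAt ℝ ρ p := (hρC p hpU).differentiableAt (by norm_num)
  have hbν : fderiv ℝ b p ν = -N := by
    rw [hDb p hpU, hρp, hDρ]; simp [hν]
  by_contra hcon
  push Not at hcon
  have hup : u p = 0 := hzero p hpU hrp
  have f1 := pos_right ((deriv_line hu' (-ν)).add ((deriv_line hb' (-ν)).const_mul ε)) (by simp [hup, hbp]) (by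
    rw [map_neg, map_neg, hbν]
    have : 0 < ε * N := by positivity
    linarith)
  have f2 := pos_right ((deriv_line hρ' (-ν)).neg) (by simp [hρp]) (by rw [map_neg, hDρ, hν]; norm_num)
  have f3 : ∀ᶠ x : ℝ in nhdsWithin 0 (Ioi 0), p + x • (-ν) ∈ closedBall p s2 := by
    have : ContinuousAt (fun x : ℝ => p + x • (-ν)) 0 := by fun_prop
    exact (this.eventually_mem (by rw [zero_smul, add_zero]; exact closedBall_mem_nhds p hs2)).filter_mono nhdsWithin_le_nhds
  obtain ⟨x, hx1, hx2, hx3⟩ := (f1.and (f2.and f3)).exists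
  have := main (p + x • (-ν)) ⟨hx3, by
    have : 0 < -ρ (p + x • (-ν)) := hx2
    change ρ (p + x • (-ν)) ≤ 0
    linarith⟩
  have hx1' : 0 < u (p + x • (-ν)) + ε * b (p + x • (-ν)) := hx1
  linarith

lemma transfer1 {r u : C2 → ℝ} {p ν : C2} (hr : DifferentiableAt ℝ r p) (hu : DifferentiableAt ℝ u p)
    (hrp : r p = 0) (hup : u p = 0) (hν : fderiv ℝ r p ν = 1)
    (hneg : ∀ᶠ z in nhds p, r z < 0 → u z < 0) {t : C2} (ht : fderiv ℝ r p t = 0) : fderiv ℝ u p t ≤ 0 := by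
  by_contra hcon
  push Not at hcon
  set c := fderiv ℝ u p ν with hc
  set a := fderiv ℝ u p t with ha
  set δ := a / (2 * (|c| + 1)) with hδ
  have hδp : 0 < δ := by positivity
  have hδc : δ * c < a := by
    have h1 : δ * (2 * (|c| + 1)) = a := by rw [hδ]; field_simp
    have h2 := le_abs_self c
    have h3 := abs_nonneg c
    nlinarith
  have f1 := pos_right (deriv_line hu (t - δ • ν)) (by simp [hup]) (by
    rw [map_sub, map_smul, ← hc, ← ha, smul_eq_mul]; linarith)
  have f2 := pos_right (deriv_line hr (t - δ • ν)).neg (by simp [hrp]) (by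
    rw [map_sub, map_smul, ht, hν, smul_eq_mul]; linarith)
  have f3 : ∀ᶠ x : ℝ in nhdsWithin 0 (Ioi 0), r (p + x • (t - δ • ν)) < 0 → u (p + x • (t - δ • ν)) < 0 := by
    have : ContinuousAt (fun x : ℝ => p + x • (t - δ • ν)) 0 := by fun_prop
    have h2 : Tendsto (fun x : ℝ => p + x • (t - δ • ν)) (nhds 0) (nhds p) := by
      simpa [ContinuousAt] using this
    exact (h2.eventually hneg).filter_mono nhdsWithin_le_nhds
  obtain ⟨x, h1, h2, h3⟩ := (f1.and (f2.and f3)).exists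
  have h2' : 0 < - r (p + x • (t - δ • ν)) := h2
  have := h3 (by linarith)
  linarith

lemma transfer2 {r Φ : C2 → ℝ} {p ν : C2} {s : ℝ} (hs : 0 < s) (hr : ∀ z ∈ ball p s, ContDiffAt ℝ 2 r z)
    (hΦ : ContDiffAt ℝ 2 Φ p) (hrp : r p = 0) (hν : fderiv ℝ r p ν = 1)
    (hzero : ∀ z ∈ ball p s, r z = 0 → Φ z = 0) (hDΦ : fderiv ℝ Φ p = 0) {t : C2} (ht : fderiv ℝ r p t = 0) :
    fderiv ℝ (fderiv ℝ Φ) p t t = 0 := by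
  by_contra hcon
  have hpU : p ∈ ball p s := mem_ball_self hs
  set B := fderiv ℝ (fderiv ℝ Φ) p with hB
  set a := |B t t| with ha
  have hap : 0 < a := abs_pos.2 hcon
  set κ := a / (4 * (‖t‖ ^ 2 + 1)) with hκ
  have hκp : 0 < κ := by positivity
  have hκt : 2 * κ * ‖t‖ ^ 2 < a := by
    have h1 : κ * (4 * (‖t‖ ^ 2 + 1)) = a := by rw [hκ]; field_simp
    have h3 := sq_nonneg ‖t‖
    nlinarith
  have hcont : ContinuousAt (fun e : ℝ => 2 * κ * ‖t + e • ν‖ ^ 2 - |B (t + e • ν) (t + e • ν)|) 0 := by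
    have h1 : ContinuousAt (fun e : ℝ => t + e • ν) 0 := by fun_prop
    have h2 : ContinuousAt (fun e : ℝ => B (t + e • ν) (t + e • ν)) 0 :=
      (B.continuous.continuousAt.comp h1).clm_apply h1
    exact (continuousAt_const.mul (h1.norm.pow 2)).sub h2.abs
  have hev : ∀ᶠ e : ℝ in nhds 0, 2 * κ * ‖t + e • ν‖ ^ 2 - |B (t + e • ν) (t + e • ν)| < 0 :=
    hcont.eventually_lt continuousAt_const (by simp only [zero_smul, add_zero]; linarith)
  obtain ⟨δ, hδ, hδb⟩ := Metric.nhds_basis_closedBall.eventually_iff.1 hev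
  obtain ⟨ε, hε, -, hT⟩ := taylor_o hΦ hκp
  have hrd := (hr p hpU).differentiableAt (by norm_num)
  have f1 := pos_right (deriv_line hrd (t + δ • ν)) (by simp [hrp]) (by
    rw [map_add, map_smul, ht, hν, smul_eq_mul]; linarith)
  have f2 := pos_right (deriv_line hrd (t + (-δ) • ν)).neg (by simp [hrp]) (by
    rw [map_add, map_smul, ht, hν, smul_eq_mul]; linarith)
  have f3 : ∀ᶠ x : ℝ in nhdsWithin 0 (Ioi 0), x * (‖t‖ + δ * ‖ν‖) < min s ε := by
    have : ContinuousAt (fun x : ℝ => x * (‖t‖ + δ * ‖ν‖)) 0 := by fun_prop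
    exact (this.eventually_lt continuousAt_const (by simp; exact ⟨hs, hε⟩)).filter_mono nhdsWithin_le_nhds
  have f4 : ∀ᶠ x : ℝ in nhdsWithin 0 (Ioi 0), 0 < x := self_mem_nhdsWithin
  obtain ⟨x, h1, h2, h3, hx⟩ := (f1.and (f2.and (f3.and f4))).exists
  have h2' : 0 < - r (p + x • (t + (-δ) • ν)) := h2
  have hin : ∀ e ∈ Icc (-δ) δ, p + x • (t + e • ν) ∈ ball p (min s ε) := by
    intro e he
    rw [mem_ball, dist_eq_norm, add_sub_cancel_left, norm_smul, Real.norm_eq_abs, abs_of_pos hx]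
    refine lt_of_le_of_lt ?_ h3
    have : ‖t + e • ν‖ ≤ ‖t‖ + |e| * ‖ν‖ := by
      refine (norm_add_le _ _).trans ?_
      rw [norm_smul, Real.norm_eq_abs]
    have h5 : |e| * ‖ν‖ ≤ δ * ‖ν‖ := by gcongr; exact abs_le.2 he
    gcongr; linarith
  have hcr : ContinuousOn (fun e : ℝ => r (p + x • (t + e • ν))) (Icc (-δ) δ) := by
    intro e he
    have h5 : ContinuousAt (fun e : ℝ => p + x • (t + e • ν)) e := by fun_prop
    have h6 := (hr _ (ball_subset_ball (min_le_left _ _) (hin e he))).continuousAt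
    exact (ContinuousAt.comp (f := fun e : ℝ => p + x • (t + e • ν)) h6 h5).continuousWithinAt
  obtain ⟨e, he, hre⟩ := intermediate_value_Icc (by linarith) hcr (show (0:ℝ) ∈ Icc _ _ from ⟨by linarith, h1.le⟩)
  have hy := hin e he
  have hΦy := hzero _ (ball_subset_ball (min_le_left _ _) hy) hre
  have hTy := hT p (mem_ball_self hε) _ (ball_subset_ball (min_le_right _ _) hy)
  rw [hΦy, hzero p hpU hrp, hDΦ, add_sub_cancel_left, ← hB] at hTy
  have hbe := hδb (show e ∈ closedBall 0 δ by rw [mem_closedBall, Real.dist_eq, sub_zero]; exact abs_le.2 he)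
  set v := t + e • ν with hv
  have e1 : B (x • v) (x • v) = x ^ 2 * B v v := by simp; ring
  have e2 : ‖x • v‖ ^ 2 = x ^ 2 * ‖v‖ ^ 2 := by rw [norm_smul, mul_pow, Real.norm_eq_abs, sq_abs]
  rw [e1, e2] at hTy
  have e3 : |(0:ℝ) - 0 - (0 : C2 →L[ℝ] ℝ) (x • v) - 1 / 2 * (x ^ 2 * B v v)| = x ^ 2 * (1 / 2 * |B v v|) := by
    rw [zero_apply]
    have : (0:ℝ) - 0 - 0 - 1 / 2 * (x ^ 2 * B v v) = -(x ^ 2 * (1 / 2 * B v v)) := by ring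
    rw [this, abs_neg, abs_mul, abs_mul, abs_of_pos (show (0:ℝ) < x ^ 2 by positivity)]
    norm_num
  rw [e3] at hTy
  have hx2 : 0 < x ^ 2 := by positivity
  have : 1 / 2 * |B v v| ≤ κ * ‖v‖ ^ 2 := le_of_mul_le_mul_left (by linarith) hx2
  linarith

lemma Loc.final {r r' : C2 → ℝ} {F : C2 → C2} {p : C2} {s m : ℝ} (H : Loc r r' F p s m) {t' : C2}
    (ht' : t' ≠ 0) (h1 : fderiv ℝ r' (F p) t' = 0) (h2 : fderiv ℝ r' (F p) (I • t') = 0) :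
    0 < LL r' (F p) t' := by
  have hpU : p ∈ ball p s := mem_ball_self H.s_pos
  obtain ⟨ν, hν⟩ := exists_one (AA_ne (H.r_D p hpU))
  have hν1 : fderiv ℝ r p ν = 1 := by rw [← AA_re, hν]; simp
  obtain ⟨C, hC, hlev⟩ := H.levi ν
  have hr2 : ∀ z ∈ ball p s, ContDiffAt ℝ 2 r z := fun z hz => (H.r_cd z hz).of_le (by norm_num)
  have hu2 : ∀ z ∈ ball p s, ContDiffAt ℝ 2 (r' ∘ F) z := fun z hz => H.uC hz
  have hc := hopf H.s_pos hr2 hu2 H.rp hν1 H.neg H.zero hC hlev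
  set u := r' ∘ F with hu
  set c := fderiv ℝ u p ν with hcd
  have hrd := (hr2 p hpU).differentiableAt (by norm_num)
  have hud := (hu2 p hpU).differentiableAt (by norm_num)
  have hup : u p = 0 := H.zero p hpU H.rp
  have hnev : ∀ᶠ z in nhds p, r z < 0 → u z < 0 := by
    filter_upwards [isOpen_ball.eventually_mem hpU] with z hz using H.neg z hz
  have hT1 : ∀ t, fderiv ℝ r p t = 0 → fderiv ℝ u p t = 0 := by
    intro t ht
    apply le_antisymm
    · exact transfer1 hrd hud H.rp hup hν1 hnev ht
    · have := transfer1 hrd hud H.rp hup hν1 hnev (t := -t) (by rw [map_neg, ht, neg_zero])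
      rw [map_neg] at this; linarith
  set Φ : C2 → ℝ := fun z => u z + (-c) * r z with hΦ
  have hcr : ContDiffAt ℝ 2 (fun z => (-c) * r z) p := contDiffAt_const.mul (hr2 p hpU)
  have hΦC : ContDiffAt ℝ 2 Φ p := (hu2 p hpU).add hcr
  have hDΦ : fderiv ℝ Φ p = 0 := by
    have e1 : fderiv ℝ Φ p = fderiv ℝ u p + fderiv ℝ (fun z => (-c) * r z) p := fderiv_add hud (hcr.differentiableAt (by norm_num))
    have e2 : fderiv ℝ (fun z => (-c) * r z) p = (-c) • fderiv ℝ r p := fderiv_const_mul hrd (-c)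
    refine ContinuousLinearMap.ext fun x => ?_
    rw [e1, e2]
    have h3 := hT1 (x - (fderiv ℝ r p x) • ν) (by rw [map_sub, map_smul, hν1]; simp)
    rw [map_sub, map_smul, ← hcd, smul_eq_mul] at h3
    simp only [add_apply, smul_apply, smul_eq_mul, zero_apply]
    linarith
  have hΦ2 : ∀ t, fderiv ℝ r p t = 0 → fderiv ℝ (fderiv ℝ Φ) p t t = 0 := fun t ht =>
    transfer2 H.s_pos hr2 hΦC H.rp hν1 (fun z hz h => by
      have h3 : u z = 0 := H.zero z hz h
      simp [hΦ, h3, h]) hDΦ ht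
  obtain ⟨t, ht0, hAt⟩ := exists_ker (AA (fderiv ℝ r p))
  obtain ⟨ht1, ht2⟩ := (AA_eq_zero_iff _ _).1 hAt
  have hLLu : 0 < LL u p t := by
    have h3 : LL Φ p t = 0 := by unfold LL; rw [hΦ2 t ht1, hΦ2 _ ht2, add_zero]
    rw [LL_add (hu2 p hpU) hcr, LL_const_mul (hr2 p hpU)] at h3
    have h4 := H.r_LL p hpU t
    have h5 : 0 < m * ‖t‖ ^ 2 := by have := H.m_pos; have := norm_pos_iff.2 ht0; positivity
    have : 0 < c * LL r p t := mul_pos hc (by linarith)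
    linarith
  have hFd : DifferentiableAt ℂ F p := (H.FC hpU).differentiableAt (by norm_num)
  have hRd : DifferentiableAt ℝ r' (F p) := (H.r'_cd p hpU).differentiableAt (by norm_num)
  have hr'2 : ContDiffAt ℝ 2 r' (F p) := (H.r'_cd p hpU).of_le (by norm_num)
  rw [hu, LL_comp (H.FC hpU) hr'2] at hLLu
  have a1 := hT1 t ht1
  have a2 := hT1 _ ht2
  rw [hu, fderiv_comp_hol hFd hRd] at a1 a2
  rw [ContinuousLinearMap.map_smul] at a2
  set τ := fderiv ℂ F p t
  obtain ⟨k, hk⟩ := ker_one_dim (AA_ne (H.r'_D p hpU)) ht' ((AA_eq_zero_iff _ _).2 ⟨h1, h2⟩) ((AA_eq_zero_iff _ _).2 ⟨a1, a2⟩)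
  rw [hk, LL_smul_complex _ _ _ hr'2] at hLLu
  exact pos_of_mul_pos_right hLLu (sq_nonneg _)

lemma main_aux
    (D D' M M' : Set C2) (f : C2 → C2)
    (Ω : Set C2) (r : C2 → ℝ) (Ω' : Set C2) (r' : C2 → ℝ)
    (hfm : Set.MapsTo f D D')
    (hMsub : M ⊆ frontier D)
    (hMopen : ∃ O : Set C2, IsOpen O ∧ M = frontier D ∩ O)
    (hM'sub : M' ⊆ frontier D')
    (hΩ : IsOpen Ω) (hMΩ : closure M ⊆ Ω)
    (hr : AnalyticOnNhd ℝ r Ω) (hrgrad : ∀ p ∈ Ω, fderiv ℝ r p ≠ 0)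
    (hrbd : frontier D ∩ Ω = {p : C2 | p ∈ Ω ∧ r p = 0})
    (hrD : D ∩ Ω = {p : C2 | p ∈ Ω ∧ r p < 0})
    (hΩ' : IsOpen Ω') (hM'Ω' : closure M' ⊆ Ω')
    (hr' : AnalyticOnNhd ℝ r' Ω') (hr'grad : ∀ p ∈ Ω', fderiv ℝ r' p ≠ 0)
    (hr'bd : frontier D' ∩ Ω' = {p : C2 | p ∈ Ω' ∧ r' p = 0})
    (hr'D : D' ∩ Ω' = {p : C2 | p ∈ Ω' ∧ r' p < 0})
    (hcl : ∀ p ∈ M, ∀ z : ℕ → C2, (∀ j, z j ∈ D) → Filter.Tendsto z Filter.atTop (nhds p) →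
      ∀ w' : C2, Filter.Tendsto (fun j => f (z j)) Filter.atTop (nhds w') → w' ∈ M')
    (p : C2) (hpM : p ∈ M)
    (W : Set C2) (hW : IsOpen W) (hpW : p ∈ W)
    (F : C2 → C2) (hF : DifferentiableOn ℂ F W) (hFf : ∀ z ∈ W ∩ D, F z = f z)
    (hpsc : StronglyPseudoconvexAt r p) :
    F p ∈ M' ∧ StronglyPseudoconvexAt r' (F p) := by
  obtain ⟨O, hO, hMO⟩ := hMopen
  have hFM : ∀ q ∈ M, q ∈ W → F q ∈ M' := by
    intro q hq hqW
    obtain ⟨z, hzD, hzq⟩ := mem_closure_iff_seq_limit.1 (frontier_subset_closure (hMsub hq))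
    refine hcl q hq z hzD hzq (F q) ?_
    have h1 : Tendsto (fun j => F (z j)) atTop (nhds (F q)) :=
      (hF.differentiableAt (hW.mem_nhds hqW)).continuousAt.tendsto.comp hzq
    refine h1.congr' ?_
    filter_upwards [hzq.eventually (hW.mem_nhds hqW)] with j hj
    exact hFf _ ⟨hj, hzD j⟩
  have hFpM := hFM p hpM hpW
  refine ⟨hFpM, ?_⟩
  have hpΩ : p ∈ Ω := hMΩ (subset_closure hpM)
  have hFpΩ : F p ∈ Ω' := hM'Ω' (subset_closure hFpM)
  have hr3 : ∀ z ∈ Ω, ContDiffAt ℝ 3 r z := fun z hz => (hr z hz).contDiffAt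
  have hr'3 : ∀ z ∈ Ω', ContDiffAt ℝ 3 r' z := fun z hz => (hr' z hz).contDiffAt
  have hrp : r p = 0 := by
    have : p ∈ frontier D ∩ Ω := ⟨hMsub hpM, hpΩ⟩
    rw [hrbd] at this; exact this.2
  have hr2 : ContDiffAt ℝ 2 r p := (hr3 p hpΩ).of_le (by norm_num)
  have hrd := hr2.differentiableAt (by norm_num)
  obtain ⟨N, hN, hpos⟩ := make_spsh hr2 hrp (by
    intro t ht h1 h2
    have := hpsc t ((tangentVec_iff hrd).2 ⟨h1, h2⟩) ht
    rw [levi_re hr2] at this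
    linarith)
  set ρ : C2 → ℝ := fun z => r z + N * r z ^ 2 with hρ
  have hρ3 : ∀ z ∈ Ω, ContDiffAt ℝ 3 ρ z := fun z hz =>
    (hr3 z hz).add (contDiffAt_const.mul ((hr3 z hz).pow 2))
  have hρ2 : ContDiffAt ℝ 2 ρ p := (hρ3 p hpΩ).of_le (by norm_num)
  obtain ⟨m, hm, hLL⟩ := LL_lower_near hρ2 hpos
  have hDρ : fderiv ℝ ρ p ≠ 0 := by
    have h1 : ∀ x : ℝ, HasDerivAt (fun x : ℝ => x + N * x ^ 2) (1 + N * (2 * x)) x := fun x => by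
      have := (hasDerivAt_id x).add (((hasDerivAt_id x).pow 2).const_mul N)
      refine this.congr_deriv ?_
      simp
    have h2 : fderiv ℝ ρ p = _ := D1_scomp hrd h1
    rw [h2, hrp]; simpa using hrgrad p hpΩ
  have hFc : ContinuousAt F p := (hF.differentiableAt (hW.mem_nhds hpW)).continuousAt
  have hpO : p ∈ O := by rw [hMO] at hpM; exact hpM.2
  have evN : ∀ᶠ z in nhds p, -1 < N * r z :=
    continuousAt_const.eventually_lt (continuousAt_const.mul hrd.continuousAt : ContinuousAt (fun z => N * r z) p) (by rw [hrp]; norm_num)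
  obtain ⟨s, hs, hb⟩ := Metric.nhds_basis_ball.eventually_iff.1
    (hLL.and ((hΩ.eventually_mem hpΩ).and ((hW.eventually_mem hpW).and ((hO.eventually_mem hpO).and
      ((hFc.eventually (hΩ'.eventually_mem hFpΩ)).and (evN.and ((contAt_D1 hρ2).eventually_ne hDρ)))))))
  have hfac : ∀ z, ρ z = r z * (1 + N * r z) := fun z => by simp only [hρ]; ring
  have H : Loc ρ r' F p s m :=
    { s_pos := hs
      m_pos := hm
      r_cd := fun z hz => hρ3 z (hb hz).2.1
      r_D := fun z hz => (hb hz).2.2.2.2.2.2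
      r_LL := fun z hz => (hb hz).1
      F_hol := hF.mono fun z hz => (hb hz).2.2.1
      r'_cd := fun z hz => hr'3 _ (hb hz).2.2.2.2.1
      r'_D := fun z hz => hr'grad _ (hb hz).2.2.2.2.1
      neg := by
        intro z hz h
        obtain ⟨-, hzΩ, hzW, hzO, hzF, hzN, -⟩ := hb hz
        rw [hfac z] at h
        have h1 : r z < 0 := by
          by_contra hc
          push Not at hc
          have : 0 ≤ r z * (1 + N * r z) := mul_nonneg hc (by linarith)
          linarith
        have h2 : z ∈ D ∩ Ω := by rw [hrD]; exact ⟨hzΩ, h1⟩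
        have h3 : F z ∈ D' ∩ Ω' := ⟨by rw [hFf z ⟨hzW, h2.1⟩]; exact hfm h2.1, hzF⟩
        rw [hr'D] at h3
        exact h3.2
      zero := by
        intro z hz h
        obtain ⟨-, hzΩ, hzW, hzO, hzF, hzN, -⟩ := hb hz
        rw [hfac z] at h
        have h1 : r z = 0 := (mul_eq_zero.1 h).resolve_right (by intro h0; linarith)
        have h2 : z ∈ frontier D ∩ Ω := by rw [hrbd]; exact ⟨hzΩ, h1⟩
        have h3 : z ∈ M := by rw [hMO]; exact ⟨h2.1, hzO⟩
        have h4 : F z ∈ frontier D' ∩ Ω' := ⟨hM'sub (hFM z h3 hzW), hzF⟩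
        rw [hr'bd] at h4
        exact h4.2
      rp := by rw [hfac, hrp, zero_mul] }
  intro t' htan ht'
  have hr'2 : ContDiffAt ℝ 2 r' (F p) := (hr'3 _ hFpΩ).of_le (by norm_num)
  obtain ⟨h1, h2⟩ := (tangentVec_iff (hr'2.differentiableAt (by norm_num))).1 htan
  rw [levi_re hr'2]
  have := H.final ht' h1 h2
  linarith

end

/-- Part of Theorem 1.2: `f(M_s⁺) ⊆ M'_s⁺`. -/
theorem stmt2
    (D D' M M' : Set C2) (f : C2 → C2)
    (Ω : Set C2) (r : C2 → ℝ) (Ω' : Set C2) (r' : C2 → ℝ)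
    -- `D`, `D'` are bounded domains in `ℂ²`
    (hD : IsOpen D) (hDconn : IsConnected D) (hDbd : Bornology.IsBounded D)
    (hD' : IsOpen D') (hD'conn : IsConnected D') (hD'bd : Bornology.IsBounded D')
    -- `f : D → D'` is proper holomorphic
    (hf : DifferentiableOn ℂ f D) (hfm : Set.MapsTo f D D')
    (hfp : ∀ K : Set C2, K ⊆ D' → IsCompact K → IsCompact (D ∩ f ⁻¹' K))
    -- `M` is a nonempty relatively open piece of `∂D`, `M'` a relatively open piece of `∂D'`
    (hMne : M.Nonempty) (hMsub : M ⊆ frontier D)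
    (hMopen : ∃ O : Set C2, IsOpen O ∧ M = frontier D ∩ O)
    (hM'sub : M' ⊆ frontier D')
    (hM'open : ∃ O : Set C2, IsOpen O ∧ M' = frontier D' ∩ O)
    -- hypothesis (i): `∂D` is smooth real-analytic of finite type near `closure M`
    (hΩ : IsOpen Ω) (hMΩ : closure M ⊆ Ω)
    (hr : AnalyticOnNhd ℝ r Ω) (hrgrad : ∀ p ∈ Ω, fderiv ℝ r p ≠ 0)
    (hrbd : frontier D ∩ Ω = {p : C2 | p ∈ Ω ∧ r p = 0})
    (hrD : D ∩ Ω = {p : C2 | p ∈ Ω ∧ r p < 0})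
    (hft : ∀ φ : ℂ → C2, DifferentiableOn ℂ φ (Metric.ball (0 : ℂ) 1) →
      (∀ ζ ∈ Metric.ball (0 : ℂ) 1, φ ζ ∈ frontier D ∩ Ω) →
      ∀ a ∈ Metric.ball (0 : ℂ) 1, ∀ b ∈ Metric.ball (0 : ℂ) 1, φ a = φ b)
    -- hypothesis (ii): `∂D'` is smooth real-analytic of finite type near `closure M'`
    (hΩ' : IsOpen Ω') (hM'Ω' : closure M' ⊆ Ω')
    (hr' : AnalyticOnNhd ℝ r' Ω') (hr'grad : ∀ p ∈ Ω', fderiv ℝ r' p ≠ 0)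
    (hr'bd : frontier D' ∩ Ω' = {p : C2 | p ∈ Ω' ∧ r' p = 0})
    (hr'D : D' ∩ Ω' = {p : C2 | p ∈ Ω' ∧ r' p < 0})
    (hft' : ∀ φ : ℂ → C2, DifferentiableOn ℂ φ (Metric.ball (0 : ℂ) 1) →
      (∀ ζ ∈ Metric.ball (0 : ℂ) 1, φ ζ ∈ frontier D' ∩ Ω') →
      ∀ a ∈ Metric.ball (0 : ℂ) 1, ∀ b ∈ Metric.ball (0 : ℂ) 1, φ a = φ b)
    -- hypothesis (iii): the cluster set of `M` under `f` is contained in `M'`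
    (hcl : ∀ p ∈ M, ∀ z : ℕ → C2, (∀ j, z j ∈ D) → Filter.Tendsto z Filter.atTop (nhds p) →
      ∀ w' : C2, Filter.Tendsto (fun j => f (z j)) Filter.atTop (nhds w') → w' ∈ M')
    (p : C2) (hpM : p ∈ M)
    (W : Set C2) (hW : IsOpen W) (hpW : p ∈ W)
    (F : C2 → C2) (hF : DifferentiableOn ℂ F W) (hFf : ∀ z ∈ W ∩ D, F z = f z)
    (hpsc : StronglyPseudoconvexAt r p) :
    F p ∈ M' ∧ StronglyPseudoconvexAt r' (F p) := by
  exact main_aux D D' M M' f Ω r Ω' r' hfm hMsub hMopen hM'sub hΩ hMΩ hr hrgrad hrbd hrD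
    hΩ' hM'Ω' hr' hr'grad hr'bd hr'D hcl p hpM W hW hpW F hF hFf hpsc
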